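/- Suppose k > ℓ ≥ 1, k+ℓ ≥ 5, and 0 ≤ λ ≤ k+ℓ−5, with p = (k+ℓ)m+2+λ prime and n ≥ 1. Let τ ∈ (0,1] be feasible for 1/(k+ℓ) and assume m ≥ 7, m ≥ k+ℓ−1, and m ≥ 5/τ. Let A ⊆ F_p^n be a nontrivial (k,ℓ)-sum-free set with |A| ≥ m·p^{n−1}. If there exists a decomposition (v,K) of F_p^n with ω(A) ≤ m+1, then A is normal, i.e., of type 1 or of type 2. -/

import Mathlib

open Pointwise

/-- `itSum h A` is the `h`-fold sumset `hA = A + ⋯ + A` (`h` copies), with `itSum 0 A = {0}`. -/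
def itSum {G : Type*} [AddCommMonoid G] : ℕ → Set G → Set G
  | 0, _ => {0}
  | h + 1, A => itSum h A + A

/-- `A` is `(k,ℓ)`-sum-free: the sumsets `kA` and `ℓA` are disjoint. -/
def KLFree {G : Type*} [AddCommMonoid G] (k l : ℕ) (A : Set G) : Prop :=
  itSum k A ∩ itSum l A = ∅

/-- The interval `[a, a+t] = {a, a+1, …, a+t}` in `ZMod p`. -/
def Ival {p : ℕ} (a : ZMod p) (t : ℕ) : Set (ZMod p) :=
  {x | ∃ i : ℕ, i ≤ t ∧ x = a + (i : ZMod p)}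

/-- The cuboid `[a, a+t] × F_p^{n'}` inside the model space `F_p × F_p^{n'}`. -/
def cub (p n' : ℕ) (a : ZMod p) (t : ℕ) : Set (ZMod p × (Fin n' → ZMod p)) :=
  {x | x.1 ∈ Ival a t}

/-- The element `a_j = -(km+1+j)·(k-ℓ)⁻¹` of `F_p`. -/
def ajElt (k l m p j : ℕ) : ZMod p :=
  -((k * m + 1 + j : ℕ) : ZMod p) * (((k - l : ℕ) : ZMod p))⁻¹

/-- The layer `A_i = (A - i·v) ∩ K` of `A` w.r.t. the decomposition `(v, K)`. -/
def layerKL {p n : ℕ} (v : Fin n → ZMod p) (K : Submodule (ZMod p) (Fin n → ZMod p))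
    (A : Set (Fin n → ZMod p)) (i : ZMod p) : Set (Fin n → ZMod p) :=
  {x | x ∈ K ∧ x + i • v ∈ A}

/-- The support `Supp(A) = {i | A_i ≠ ∅}` w.r.t. the decomposition `(v, K)`. -/
def supp {p n : ℕ} (v : Fin n → ZMod p) (K : Submodule (ZMod p) (Fin n → ZMod p))
    (A : Set (Fin n → ZMod p)) : Set (ZMod p) :=
  {i | (layerKL v K A i).Nonempty}

/-- The weight `ω(A) = |Supp(A)|` w.r.t. the decomposition `(v, K)`. -/
noncomputable def weight {p n : ℕ} (v : Fin n → ZMod p)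
    (K : Submodule (ZMod p) (Fin n → ZMod p)) (A : Set (Fin n → ZMod p)) : ℕ :=
  (supp v K A).ncard

/-- `A ⊆ F_p^n` is trivial: isomorphic to a subset of some extremal cuboid `A_{k,ℓ,p,j}`. -/
def IsTrivialKL (k l m lam p n : ℕ) (A : Set (Fin n → ZMod p)) : Prop :=
  ∃ (e : (Fin n → ZMod p) ≃+ (ZMod p × (Fin (n - 1) → ZMod p))) (j : ℕ),
    j < (lam + 2) / 2 ∧ e '' A ⊆ cub p (n - 1) (ajElt k l m p j) m

/-- Type 1. -/
def IsType1 (k l m lam p n : ℕ) (A : Set (Fin n → ZMod p)) : Prop :=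
  A.ncard = m * p ^ (n - 1) ∧
  ∃ (e : (Fin n → ZMod p) ≃+ (ZMod p × (Fin (n - 1) → ZMod p))) (a : ZMod p),
    ((l : ZMod p) * a - (k : ZMod p) * (a + (m : ZMod p) - 1) ∈ Ival (1 : ZMod p) (l - 1) ∨
      (lam + l + 2 ≤ k ∧
        (l : ZMod p) * a - (k : ZMod p) * (a + (m : ZMod p) - 1) ∈
          Ival ((lam + l + 2 : ℕ) : ZMod p) (k - (lam + l + 2)))) ∧
    e '' A = cub p (n - 1) a (m - 1)

/-- The element `a = m·k·(ℓ-k)⁻¹` of `F_p` used in type 2. -/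
def type2a (k l m p : ℕ) : ZMod p :=
  (m : ZMod p) * (k : ZMod p) * (((l : ZMod p) - (k : ZMod p))⁻¹)

/-- Type 2. -/
def IsType2 (k l m p n : ℕ) (A : Set (Fin n → ZMod p)) : Prop :=
  l = 1 ∧ 2 ≤ n ∧ A.ncard = m * p ^ (n - 1) ∧
  ∃ (e : (Fin n → ZMod p) ≃+ (ZMod p × (Fin (n - 1) → ZMod p)))
      (V : Submodule (ZMod p) (Fin (n - 1) → ZMod p)),
    V ≠ ⊤ ∧
    e '' A =
      ({type2a k l m p} ×ˢ (Set.univ \ (V : Set (Fin (n - 1) → ZMod p)))) ∪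
        ((Ival (type2a k l m p + 1) (m - 2)) ×ˢ (Set.univ : Set (Fin (n - 1) → ZMod p))) ∪
        ({type2a k l m p + (m : ZMod p)} ×ˢ (V : Set (Fin (n - 1) → ZMod p)))

/-- Normal: of type 1 or type 2. -/
def IsNormalKL (k l m lam p n : ℕ) (A : Set (Fin n → ZMod p)) : Prop :=
  IsType1 k l m lam p n A ∨ IsType2 k l m p n A

/-- The element `a = (ℓm+k-1)·(k-ℓ)⁻¹` of `F_p` used in type 3. -/
def type3a (k l m p : ℕ) : ZMod p :=
  ((l * m + k - 1 : ℕ) : ZMod p) * (((k - l : ℕ) : ZMod p))⁻¹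

/-- Type 3. -/
def IsType3 (k l m p n : ℕ) (A : Set (Fin n → ZMod p)) : Prop :=
  A.ncard = m * p ^ (n - 1) ∧
  ∃ e : (Fin n → ZMod p) ≃+ (ZMod p × (Fin (n - 1) → ZMod p)),
    e '' A = {x | x.1 ∈ Ival (type3a k l m p - 1) (m + 1) \
      {type3a k l m p, type3a k l m p + (m : ZMod p) - 1}}

/-- Type 4 (for `p = 5m+3`). -/
def IsType4 (m p n : ℕ) (A : Set (Fin n → ZMod p)) : Prop :=
  2 ≤ n ∧ A.ncard = m * p ^ (n - 1) ∧
  ∃ (e : (Fin n → ZMod p) ≃+ (ZMod p × (Fin (n - 1) → ZMod p)))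
      (V : Submodule (ZMod p) (Fin (n - 1) → ZMod p)),
    V ≠ ⊤ ∧
    e '' A =
      (({((2 * m + 1 : ℕ) : ZMod p), ((3 * m + 2 : ℕ) : ZMod p)} : Set (ZMod p)) ×ˢ
          (V : Set (Fin (n - 1) → ZMod p))) ∪
        (({((2 * m + 2 : ℕ) : ZMod p), ((3 * m + 1 : ℕ) : ZMod p)} : Set (ZMod p)) ×ˢ
          (Set.univ \ (V : Set (Fin (n - 1) → ZMod p)))) ∪
        ((Ival ((2 * m + 3 : ℕ) : ZMod p) (m - 3)) ×ˢ (Set.univ : Set (Fin (n - 1) → ZMod p)))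

/-- The set `A₀ ⊆ F_p × F_p^s` used in type 5 (for `p = 4m+3`), with `a = (m+2)/2`. -/
def type5A0 (m p s : ℕ) (P : Set (Fin s → ZMod p)) : Set (ZMod p × (Fin s → ZMod p)) :=
  {(((m + 2 : ℕ) : ZMod p) * (2 : ZMod p)⁻¹ - 1, (0 : Fin s → ZMod p))} ∪
    ({((m + 2 : ℕ) : ZMod p) * (2 : ZMod p)⁻¹} ×ˢ (Set.univ \ P)) ∪
    ((Ival (((m + 2 : ℕ) : ZMod p) * (2 : ZMod p)⁻¹ + 1) (m - 3)) ×ˢ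
      (Set.univ : Set (Fin s → ZMod p))) ∪
    ({((m + 2 : ℕ) : ZMod p) * (2 : ZMod p)⁻¹ + (m : ZMod p) - 1} ×ˢ
      (Set.univ \ {(0 : Fin s → ZMod p)})) ∪
    ({((m + 2 : ℕ) : ZMod p) * (2 : ZMod p)⁻¹ + (m : ZMod p)} ×ˢ P)

/-- Type 5 (for `p = 4m+3`). -/
def IsType5 (m p n : ℕ) (A : Set (Fin n → ZMod p)) : Prop :=
  A.ncard = m * p ^ (n - 1) ∧
  ∃ s : ℕ, s ≤ n - 1 ∧
    ∃ (e : (Fin n → ZMod p) ≃+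
          (ZMod p × (Fin s → ZMod p) × (Fin (n - 1 - s) → ZMod p)))
      (P : Set (Fin s → ZMod p)),
      P.Nonempty ∧ (0 : Fin s → ZMod p) ∉ itSum 3 P ∧
      e '' A = {x | (x.1, x.2.1) ∈ type5A0 m p s P}

/-- `τ` is feasible for `c`. -/
def Feasible (c τ : ℝ) : Prop :=
  ∀ q : ℕ, q.Prime → ∀ B : Set (ZMod q),
    (B.ncard : ℝ) ≤ c * q →
    ((B + B).ncard : ℝ) ≤ (2 + τ) * (B.ncard : ℝ) - 3 →
    ∃ y d : ZMod q, d ≠ 0 ∧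
      B ⊆ {x | ∃ i : ℕ, i ≤ (B + B).ncard - B.ncard ∧ x = y + (i : ZMod q) * d}

section IteratedSumset

variable {G H : Type*} [AddCommMonoid G] [AddCommMonoid H]

theorem itSum_succ (j : ℕ) (A : Set G) : itSum (j + 1) A = itSum j A + A := rfl

theorem itSum_one (A : Set G) : itSum 1 A = A := by
  rw [itSum_succ]; exact Set.singleton_add.trans (by simp)

theorem itSum_two (A : Set G) : itSum 2 A = A + A := by
  rw [itSum_succ, itSum_one]

theorem itSum_add (a b : ℕ) (A : Set G) : itSum (a + b) A = itSum a A + itSum b A := by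
  induction b with
  | zero => exact (Set.add_singleton.trans (by simp)).symm
  | succ b ih => rw [← Nat.add_assoc, itSum_succ, itSum_succ, ih, add_assoc]

theorem itSum_mono {A B : Set G} (h : A ⊆ B) (j : ℕ) : itSum j A ⊆ itSum j B := by
  induction j with
  | zero => exact subset_rfl
  | succ j ih => exact Set.add_subset_add ih h

theorem itSum_image (f : G →+ H) (A : Set G) (j : ℕ) : itSum j (f '' A) = f '' itSum j A := by
  induction j with
  | zero => simp [itSum]
  | succ j ih => rw [itSum_succ, itSum_succ, Set.image_add, ih]

theorem nsmul_mem_itSum {A : Set G} {a : G} (ha : a ∈ A) (j : ℕ) : j • a ∈ itSum j A := by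
  induction j with
  | zero => simp [itSum]
  | succ j ih => rw [itSum_succ, succ_nsmul]; exact Set.add_mem_add ih ha

theorem KLFree.disjoint {k l : ℕ} {A : Set G} (h : KLFree k l A) {x : G} (hk : x ∈ itSum k A) :
    x ∉ itSum l A := fun hl => by
  have : x ∈ itSum k A ∩ itSum l A := ⟨hk, hl⟩
  rw [h] at this; exact this

theorem KLFree.of_disjoint {k l : ℕ} {A : Set G} (h : ∀ x ∈ itSum k A, x ∉ itSum l A) :
    KLFree k l A :=
  Set.eq_empty_of_forall_notMem fun x hx => h x hx.1 hx.2

theorem KLFree.image_equiv {k l : ℕ} {A : Set G} (h : KLFree k l A) (e : G ≃+ H) :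
    KLFree k l (e '' A) := by
  have h1 := itSum_image (e : G →+ H) A k
  have h2 := itSum_image (e : G →+ H) A l
  simp only [AddMonoidHom.coe_coe] at h1 h2
  rw [KLFree, h1, h2, ← Set.image_inter e.injective, h, Set.image_empty]

end IteratedSumset

section Intervals

variable {p : ℕ}

theorem itSum_interval {S : Set (ZMod p)} {y : ZMod p} {M : ℕ}
    (h : ∀ i : ℕ, i ≤ M → y + i ∈ S) (q z : ℕ) (hz : z ≤ q * M) :
    (q * y + z : ZMod p) ∈ itSum q S := by
  induction q generalizing z with
  | zero => obtain rfl : z = 0 := by omega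
            simp [itSum]
  | succ q ih =>
    have h1 : z - min z M ≤ q * M := by
      rw [Nat.succ_mul] at hz; omega
    refine Set.mem_add.2 ⟨_, ih _ h1, _, h (min z M) (min_le_right _ _), ?_⟩
    have : (z : ZMod p) = ((z - min z M : ℕ) : ZMod p) + ((min z M : ℕ) : ZMod p) := by
      rw [← Nat.cast_add]; congr 1; omega
    rw [this]; push_cast; ring

theorem interval_add {X S : Set (ZMod p)} {a y : ZMod p} {lo hi U : ℕ}
    (hX : ∀ z : ℕ, lo ≤ z → z ≤ hi → a + z ∈ X) (hy : y ∈ S) (hU : y + U ∈ S)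
    (h : lo + U ≤ hi + 1) (z : ℕ) (hz : lo ≤ z) (hz' : z ≤ hi + U) :
    a + y + z ∈ X + S := by
  by_cases hc : z ≤ hi
  · exact Set.mem_add.2 ⟨_, hX z hz hc, _, hy, by ring⟩
  · refine Set.mem_add.2 ⟨_, hX (z - U) (by omega) (by omega), _, hU, ?_⟩
    rw [Nat.cast_sub (by omega)]; ring

theorem interval_add_itSum {X S : Set (ZMod p)} {a y : ZMod p} {lo hi U : ℕ}
    (hX : ∀ z : ℕ, lo ≤ z → z ≤ hi → a + z ∈ X) (hy : y ∈ S) (hU : y + U ∈ S)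
    (h : lo + U ≤ hi + 1) (q z : ℕ) (hz : lo ≤ z) (hz' : z ≤ hi + q * U) :
    a + q * y + z ∈ X + itSum q S := by
  induction q generalizing z with
  | zero => exact Set.mem_add.2 ⟨_, hX z hz (by omega), 0, rfl, by simp⟩
  | succ q ih =>
    rw [itSum_succ, ← add_assoc]
    have := interval_add (hi := hi + q * U) ih hy hU (by nlinarith) z hz
      (by rw [Nat.succ_mul] at hz'; omega)
    push_cast
    convert this using 1
    ring

/-- If an interval of length `a` avoids an arithmetic progression whose difference is at most `a`,
then the progression does not wrap around the interval. -/
theorem chain_avoids [NeZero p] {F Y : Set (ZMod p)} (hFY : ∀ x ∈ F, x ∉ Y) {α β : ZMod p}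
    {a r δ : ℕ} (hI : ∀ i : ℕ, i < a → α + i ∈ F) (hC : ∀ i : ℕ, i ≤ r → β + (i * δ : ℕ) ∈ Y)
    (hδ : δ ≤ a) : ∃ v : ℕ, a ≤ v ∧ v + r * δ < p ∧ β = α + v := by
  have hv : (((β - α).val : ℕ) : ZMod p) = β - α := by simp
  refine ⟨(β - α).val, ?_, ?_, by rw [hv]; ring⟩
  · by_contra! hlt
    refine hFY _ (hI _ hlt) ?_
    have := hC 0 (Nat.zero_le _)
    rw [hv]; convert this using 1; simp
  · have key : ∀ i : ℕ, i ≤ r → (β - α).val + i * δ < p := by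
      intro i
      induction i with
      | zero => intro _; simpa using ZMod.val_lt (β - α)
      | succ i ih =>
        intro hi
        have h1 := ih (by omega)
        by_contra! hge
        rw [Nat.succ_mul] at hge
        refine hFY _ (hI ((β - α).val + (i * δ + δ) - p) (by omega)) ?_
        have := hC (i + 1) hi
        rw [Nat.cast_sub (by omega), Nat.cast_add, hv]
        convert this using 1
        push_cast
        rw [ZMod.natCast_self]; ring
    exact key r le_rfl

theorem nsmul_add_mul_mem_itSum {S : Set (ZMod p)} {y : ZMod p} {U : ℕ} (hy : y ∈ S)
    (hU : y + U ∈ S) (q i : ℕ) (hi : i ≤ q) : (q * y + (i * U : ℕ) : ZMod p) ∈ itSum q S := by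
  have := Set.add_mem_add (nsmul_mem_itSum hU i) (nsmul_mem_itSum hy (q - i))
  rw [← itSum_add, Nat.add_sub_cancel' hi] at this
  convert this using 1
  simp only [nsmul_eq_mul]
  push_cast [Nat.cast_sub hi]
  ring

/-- Doubling an interval of length `m + 1` with one interior point removed. -/
theorem gap_add_gap {S : Set (ZMod p)} {y : ZMod p} {m g : ℕ} (hg : 0 < g) (hgm : g < m)
    (h : ∀ i : ℕ, i ≤ m → i ≠ g → y + i ∈ S) (z : ℕ) (hz : 2 ≤ z) (hz' : z ≤ 2 * m - 2) :
    y + y + z ∈ S + S := by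
  have key : ∀ i j : ℕ, i ≤ m → j ≤ m → i ≠ g → j ≠ g → i + j = z → y + y + z ∈ S + S := by
    intro i j hi hj hig hjg hij
    refine Set.mem_add.2 ⟨_, h i hi hig, _, h j hj hjg, ?_⟩
    rw [← hij]; push_cast; ring
  by_cases h1 : z ≤ m
  · by_cases h2 : z = g
    · exact key 1 (z - 1) (by omega) (by omega) (by omega) (by omega) (by omega)
    · exact key 0 z (by omega) h1 (by omega) h2 (by omega)
  · by_cases h2 : z - m = g
    · exact key (m - 1) (z - m + 1) (by omega) (by omega) (by omega) (by omega) (by omega)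
    · exact key m (z - m) (by omega) (by omega) (by omega) h2 (by omega)

end Intervals

section MissingElements

variable {T : Finset ℕ} {M : ℕ}

theorem mod_notMem_of_notMem_itSum (h0 : 0 ∈ T) (hM : M ∈ T) (j x : ℕ)
    (hx : x ≤ (j + 1) * M) (hxT : x ∉ itSum (j + 1) (T : Set ℕ)) : x % M ∉ T := by
  induction j generalizing x with
  | zero =>
    rw [zero_add, itSum_one] at hxT
    rcases lt_or_eq_of_le (by simpa using hx : x ≤ M) with h | rfl
    · rwa [Nat.mod_eq_of_lt h]
    · exact absurd hM hxT
  | succ j ih =>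
    by_cases h : x ≤ (j + 1) * M
    · exact ih x h fun hx' => hxT (Set.mem_add.2 ⟨x, hx', 0, h0, by simp⟩)
    · have hMx : M ≤ x := by nlinarith
      rw [← Nat.sub_add_cancel hMx, Nat.add_mod_right]
      refine ih _ ?_ fun hx' => hxT (Set.mem_add.2 ⟨_, hx', M, hM, Nat.sub_add_cancel hMx⟩)
      rw [Nat.succ_mul (j + 1)] at hx; omega

theorem mem_itSum_two_or (hT : 2 * (Finset.range (M + 1) \ T).card < M)
    {x : ℕ} (hx : x < M) :
    x ∈ itSum 2 (T : Set ℕ) ∨ x + M ∈ itSum 2 (T : Set ℕ) := by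
  rw [itSum_two]
  by_contra! hcon
  obtain ⟨h1, h2⟩ := hcon
  have hmaps : Set.MapsTo (fun a => if a ≤ x then x - a else x + M - a)
      (Finset.range M ∩ T : Finset ℕ) (Finset.range (M + 1) \ T : Finset ℕ) := by
    intro a ha
    simp only [Finset.coe_inter, Finset.coe_range, Set.mem_inter_iff, Set.mem_Iio,
      Finset.mem_coe] at ha
    simp only [Finset.coe_sdiff, Finset.coe_range, Set.mem_sdiff, Set.mem_Iio, Finset.mem_coe]
    split_ifs with hax
    · exact ⟨by omega, fun hb => h1 (Set.mem_add.2 ⟨a, ha.2, x - a, hb, by omega⟩)⟩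
    · exact ⟨by omega, fun hb => h2 (Set.mem_add.2 ⟨a, ha.2, x + M - a, hb, by omega⟩)⟩
  have hinj : Set.InjOn (fun a => if a ≤ x then x - a else x + M - a)
      (Finset.range M ∩ T : Finset ℕ) := by
    intro a ha b hb hab
    simp only [Finset.coe_inter, Finset.coe_range, Set.mem_inter_iff, Set.mem_Iio] at ha hb
    simp only at hab
    split_ifs at hab <;> omega
  have hle := Finset.card_le_card_of_injOn _ hmaps hinj
  have hsplit := Finset.card_inter_add_card_sdiff (Finset.range M) T
  have hsub : (Finset.range M \ T).card ≤ (Finset.range (M + 1) \ T).card :=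
    Finset.card_le_card (Finset.sdiff_subset_sdiff (by simp) subset_rfl)
  rw [Finset.card_range] at hsplit
  omega

theorem mem_itSum_or_of_congr (hT : 2 * (Finset.range (M + 1) \ T).card < M)
    (h0 : 0 ∈ T) (hM : M ∈ T) (j x i : ℕ) (hx : x + (i + 1) * M ≤ (j + 1) * M) :
    x ∈ itSum (j + 1) (T : Set ℕ) ∨ x + (i + 1) * M ∈ itSum (j + 1) (T : Set ℕ) := by
  have hM0 : 0 < M := by omega
  have add0 : ∀ {a b : ℕ}, a ∈ itSum b (T : Set ℕ) → a ∈ itSum (b + 1) (T : Set ℕ) :=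
    fun h => Set.mem_add.2 ⟨_, h, 0, h0, by simp⟩
  have addM : ∀ {a b : ℕ}, a ∈ itSum b (T : Set ℕ) → a + M ∈ itSum (b + 1) (T : Set ℕ) :=
    fun h => Set.mem_add.2 ⟨_, h, M, hM, rfl⟩
  induction j generalizing x i with
  | zero =>
    left
    obtain rfl : x = 0 := by nlinarith
    rw [zero_add, itSum_one]; exact h0
  | succ j ih =>
    by_cases h1 : x + (i + 1) * M ≤ (j + 1) * M
    · exact (ih x i h1).imp add0 add0
    by_cases h2 : M ≤ x
    · have h3 : x - M + (i + 1) * M ≤ (j + 1) * M := by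
        rw [Nat.succ_mul (j + 1)] at hx; omega
      refine (ih (x - M) i h3).imp (fun h => ?_) (fun h => ?_)
      · simpa [Nat.sub_add_cancel h2] using addM h
      · have := addM h
        rwa [show x - M + (i + 1) * M + M = x + (i + 1) * M by omega] at this
    · rcases i with _ | i
      · have hj : j = 0 := by
          by_contra hj
          have : 1 ≤ j := Nat.one_le_iff_ne_zero.2 hj
          nlinarith
        subst hj
        simpa using mem_itSum_two_or hT (by omega : x < M)
      · have h3 : x + (i + 1) * M ≤ (j + 1) * M := by
          rw [Nat.succ_mul (j + 1), Nat.succ_mul (i + 1)] at hx; omega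
        refine (ih x i h3).imp add0 (fun h => ?_)
        have := addM h
        rwa [add_assoc x, ← Nat.succ_mul] at this

open Classical in
/-- The iterated sumsets of a set `T ⊆ [0, M]` containing both endpoints miss at most as many
elements of `[0, (j + 1) M]` as `T` misses in `[0, M]`. -/
theorem card_missing_itSum_le (hT : 2 * (Finset.range (M + 1) \ T).card < M)
    (h0 : 0 ∈ T) (hM : M ∈ T) (j : ℕ) :
    ((Finset.range ((j + 1) * M + 1)).filter (· ∉ itSum (j + 1) (T : Set ℕ))).card ≤
      (Finset.range (M + 1) \ T).card := by
  have hM0 : 0 < M := by omega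
  refine Finset.card_le_card_of_injOn (· % M) ?_ ?_
  · intro x hx
    simp only [Finset.coe_filter, Finset.mem_range, Set.mem_ofPred_eq] at hx
    simp only [Finset.coe_sdiff, Finset.coe_range, Set.mem_sdiff, Set.mem_Iio, Finset.mem_coe]
    exact ⟨(Nat.mod_lt _ hM0).trans (Nat.lt_succ_self _),
      mod_notMem_of_notMem_itSum h0 hM j x (by omega) hx.2⟩
  · have key : ∀ x y : ℕ, x < y → y ≤ (j + 1) * M → x % M = y % M →
        x ∉ itSum (j + 1) (T : Set ℕ) → y ∉ itSum (j + 1) (T : Set ℕ) → False := by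
      intro x y hxy hy hmod hx hy'
      obtain ⟨c, hc⟩ := (Nat.modEq_iff_dvd' hxy.le).1 hmod
      obtain ⟨i, rfl⟩ : ∃ i, c = i + 1 := Nat.exists_eq_succ_of_ne_zero (by rintro rfl; omega)
      have hyx : y = x + (i + 1) * M := by rw [mul_comm (i + 1)]; omega
      subst hyx
      exact (mem_itSum_or_of_congr hT h0 hM j x i hy).elim hx hy'
    intro x hx y hy hxy
    simp only [Finset.coe_filter, Finset.mem_range, Set.mem_ofPred_eq] at hx hy
    rcases lt_trichotomy x y with h | h | h
    · exact (key x y h (by omega) hxy hx.2 hy.2).elim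
    · exact h
    · exact (key y x h (by omega) hxy.symm hy.2 hx.2).elim

end MissingElements

/-- The numerical hypotheses on the parameters. -/
structure KLParams (k l m lam p : ℕ) : Prop where
  hlk : l < k
  hl : 1 ≤ l
  hkl : 5 ≤ k + l
  hlam : lam + 5 ≤ k + l
  hp : p = (k + l) * m + 2 + lam
  hpp : p.Prime
  hm7 : 7 ≤ m
  hmkl : k + l ≤ m + 1

section Support

variable {p : ℕ}

theorem ncard_add_ge (hp : p.Prime) {X Y : Set (ZMod p)} (hX : X.Nonempty) (hY : Y.Nonempty) :
    min p (X.ncard + Y.ncard - 1) ≤ (X + Y).ncard := by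
  classical
  have : NeZero p := ⟨hp.ne_zero⟩
  have hX' : X.toFinset.Nonempty := by simpa using hX
  have hY' : Y.toFinset.Nonempty := by simpa using hY
  have := ZMod.cauchy_davenport hp hX' hY'
  rw [Set.ncard_eq_toFinset_card' X, Set.ncard_eq_toFinset_card' Y,
    Set.ncard_eq_toFinset_card' (X + Y)]
  convert this using 2
  simp [Set.toFinset_add]

theorem itSum_nonempty {G : Type*} [AddCommMonoid G] {S : Set G} (hS : S.Nonempty) (j : ℕ) :
    (itSum j S).Nonempty := hS.elim fun _ ha => ⟨_, nsmul_mem_itSum ha j⟩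

theorem ncard_add_ncard_le_of_disjoint {α : Type*} [Finite α] {X Y : Set α}
    (h : ∀ x ∈ X, x ∉ Y) : X.ncard + Y.ncard ≤ Nat.card α := by
  rw [← Set.ncard_union_eq (Set.disjoint_left.2 h)]
  exact Set.ncard_le_card _

theorem ncard_itSum_ge_of_doubling (hp : p.Prime) {S : Set (ZMod p)} {m : ℕ}
    (hm : 1 ≤ m) (hS : m ≤ S.ncard) (hD : 2 * m + 3 ≤ (S + S).ncard) (j : ℕ) :
    min p ((j + 1) * m + j) ≤ (itSum (j + 1) S).ncard := by
  have : NeZero p := ⟨hp.ne_zero⟩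
  have hne : S.Nonempty := Set.nonempty_of_ncard_ne_zero (by omega)
  induction j using Nat.strong_induction_on with
  | _ j ih =>
    match j with
    | 0 => rw [zero_add, itSum_one]; exact (min_le_right _ _).trans (by omega)
    | 1 => rw [itSum_two]; exact (min_le_right _ _).trans (by omega)
    | j + 2 =>
      have h1 := ih j (by omega)
      rw [show j + 2 + 1 = (j + 1) + 2 by ring, itSum_add, itSum_two]
      have h2 := ncard_add_ge hp (itSum_nonempty hne (j + 1)) (hne.add hne)
      refine le_trans ?_ h2
      have : (j + 1 + 2) * m + (j + 2) = (j + 1) * m + j + (2 * m + 2) := by ring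
      omega

variable {k l m lam : ℕ}

theorem KLParams.card_double_le (P : KLParams k l m lam p) {S : Set (ZMod p)}
    (hS : m ≤ S.ncard) (hfree : KLFree k l S) : (S + S).ncard ≤ 2 * m + 2 := by
  have : NeZero p := ⟨P.hpp.ne_zero⟩
  obtain ⟨hlk, hl, hkl, hlam, hp, hpp, hm7, hmkl⟩ := P
  have hne : S.Nonempty := Set.nonempty_of_ncard_ne_zero (by omega)
  by_contra! hD
  have hk := ncard_itSum_ge_of_doubling hpp (by omega) hS (by omega) (k - 1)
  have hl' := ncard_itSum_ge_of_doubling hpp (by omega) hS (by omega) (l - 1)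
  rw [Nat.sub_add_cancel (by omega)] at hk hl'
  have hsum := ncard_add_ncard_le_of_disjoint (fun x hx => hfree.disjoint hx)
  have h1 := (Set.ncard_pos).2 (itSum_nonempty hne k)
  have h2 := (Set.ncard_pos).2 (itSum_nonempty hne l)
  rw [Nat.card_zmod] at hsum
  rw [add_mul] at hp
  omega

open Classical in
theorem ncard_itSum_ge_of_hull (hp : p.Prime) {S : Set (ZMod p)} {T : Finset ℕ} {M h : ℕ}
    {y d : ZMod p} (hd : d ≠ 0) (hTS : ∀ i ∈ T, y + i * d ∈ S)
    (hh : (Finset.range (M + 1) \ T).card ≤ h) (hhM : 2 * h < M) (h0 : 0 ∈ T) (hM : M ∈ T)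
    (j : ℕ) : min p ((j + 1) * M + 1) ≤ (itSum (j + 1) S).ncard + h := by
  have : Fact p.Prime := ⟨hp⟩
  have hmem : ∀ j : ℕ, ∀ x ∈ itSum j (T : Set ℕ), (j * y + x * d : ZMod p) ∈ itSum j S := by
    intro j
    induction j with
    | zero => intro x hx; obtain rfl : x = 0 := hx; simp [itSum]
    | succ j ih =>
      intro x hx
      obtain ⟨a, ha, b, hb, rfl⟩ := Set.mem_add.1 hx
      refine Set.mem_add.2 ⟨_, ih a ha, _, hTS b hb, ?_⟩
      push_cast; ring
  set r := min p ((j + 1) * M + 1) with hr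
  have hmiss := card_missing_itSum_le (by omega) h0 hM j
  have hle : ((Finset.range r).filter (· ∉ itSum (j + 1) (T : Set ℕ))).card ≤ h := by
    refine (Finset.card_le_card (Finset.filter_subset_filter _ ?_)).trans (hmiss.trans hh)
    exact Finset.range_subset_range.2 (min_le_right _ _)
  have hsplit := Finset.card_filter_add_card_filter_not (s := Finset.range r)
    (· ∈ itSum (j + 1) (T : Set ℕ))
  rw [Finset.card_range] at hsplit
  have himg : ((Finset.range r).filter (· ∈ itSum (j + 1) (T : Set ℕ))).card ≤
      (itSum (j + 1) S).ncard := by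
    rw [← Set.ncard_coe_finset]
    refine Set.ncard_le_ncard_of_injOn (fun x : ℕ => ((j + 1 : ℕ) * y + x * d : ZMod p)) ?_ ?_
    · intro x hx
      simp only [Finset.coe_filter, Set.mem_ofPred_eq] at hx
      exact hmem _ x hx.2
    · intro a ha b hb hab
      simp only [Finset.coe_filter, Finset.mem_range, Set.mem_ofPred_eq] at ha hb
      have : (a : ZMod p) = b := mul_right_cancel₀ hd (add_left_cancel hab)
      rw [ZMod.natCast_eq_natCast_iff'] at this
      rwa [Nat.mod_eq_of_lt (by omega), Nat.mod_eq_of_lt (by omega)] at this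
  omega

theorem KLParams.hull_le (P : KLParams k l m lam p) {S : Set (ZMod p)}
    (hS : S.ncard = m) (hfree : KLFree k l S) {T : Finset ℕ} {M : ℕ}
    {y d : ZMod p} (hd : d ≠ 0) (hTS : ∀ i ∈ T, y + i * d ∈ S) (hTM : T ⊆ Finset.range (M + 1))
    (hT : T.card = m) (h0 : 0 ∈ T) (hM : M ∈ T) (hMm : M ≤ m + 2) : M ≤ m := by
  have : NeZero p := ⟨P.hpp.ne_zero⟩
  obtain ⟨hlk, hl, hkl, hlam, hp, hpp, hm7, hmkl⟩ := P
  by_contra! hlt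
  have hcard : (Finset.range (M + 1) \ T).card = M + 1 - m := by
    rw [Finset.card_sdiff_of_subset hTM, Finset.card_range, hT]
  have hne : S.Nonempty := Set.nonempty_of_ncard_ne_zero (by omega)
  have hk := ncard_itSum_ge_of_hull hpp hd hTS hcard.le (by omega) h0 hM (k - 1)
  have hl' := ncard_itSum_ge_of_hull hpp hd hTS hcard.le (by omega) h0 hM (l - 1)
  rw [Nat.sub_add_cancel (by omega)] at hk hl'
  have hsum := ncard_add_ncard_le_of_disjoint (fun x hx => hfree.disjoint hx)
  rw [Nat.card_zmod] at hsum
  have hge : ∀ j, 1 ≤ j → m ≤ (itSum j S).ncard := by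
    intro j hj
    obtain ⟨i, rfl⟩ := Nat.exists_eq_add_of_le' hj
    obtain ⟨a, ha⟩ := itSum_nonempty hne i
    rw [← hS, itSum_succ, ← Set.ncard_image_of_injective S (add_right_injective a)]
    refine Set.ncard_le_ncard ?_
    rintro _ ⟨b, hb, rfl⟩
    exact Set.add_mem_add ha hb
  have h1 := hge k (by omega)
  have h2 := hge l hl
  obtain ⟨c, rfl⟩ : ∃ c, M = m + 1 + c := Nat.exists_eq_add_of_le hlt
  have hc : c = 0 ∨ c = 1 := by omega
  have e1 : k * (m + 1 + c) + l * (m + 1 + c) = (k + l) * m + (k + l) + c * (k + l) := by ring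
  rcases hc with rfl | rfl <;> omega

/-- A `(k,ℓ)`-sum-free subset of `F_p` with `m` elements lies in a progression of length
`m + 1`. -/
theorem KLParams.exists_progression (P : KLParams k l m lam p) {τ : ℝ} (hτ0 : 0 < τ)
    (hfeas : Feasible (1 / (k + l : ℝ)) τ) (hm1 : 5 / τ ≤ (m : ℝ)) {S : Set (ZMod p)}
    (hS : S.ncard = m) (hfree : KLFree k l S) :
    ∃ y d : ZMod p, d ≠ 0 ∧ ∀ s ∈ S, ∃ i : ℕ, i ≤ m ∧ s = y + i * d := by
  classical
  have : Fact p.Prime := ⟨P.hpp⟩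
  have hD := P.card_double_le hS.ge hfree
  have hP := P
  obtain ⟨hlk, hl, hkl, hlam, hp, hpp, hm7, hmkl⟩ := P
  have hp2 : 2 * m < p := by rw [hp]; nlinarith
  obtain ⟨y, d, hd, hsub⟩ := hfeas p hpp S (by
      have : (0 : ℝ) < k + l := by exact_mod_cast (by omega : 0 < k + l)
      rw [hS, one_div, inv_mul_eq_div, le_div_iff₀ this]
      exact_mod_cast (by rw [hp, mul_comm]; omega : m * (k + l) ≤ p)) (by
      rw [div_le_iff₀ hτ0] at hm1
      rw [hS]
      have : ((S + S).ncard : ℝ) ≤ 2 * m + 2 := by exact_mod_cast hD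
      nlinarith)
  rw [hS] at hsub
  set T : Finset ℕ := (Finset.range (m + 3)).filter (fun i => y + (i : ZMod p) * d ∈ S) with hTdef
  have hinj : Set.InjOn (fun i : ℕ => y + (i : ZMod p) * d) T := by
    intro a ha b hb hab
    simp only [hTdef, Finset.coe_filter, Finset.mem_range, Set.mem_ofPred_eq] at ha hb
    have : (a : ZMod p) = b := mul_right_cancel₀ hd (add_left_cancel hab)
    rw [ZMod.natCast_eq_natCast_iff'] at this
    rwa [Nat.mod_eq_of_lt (by omega), Nat.mod_eq_of_lt (by omega)] at this
  have himg : (fun i : ℕ => y + (i : ZMod p) * d) '' T = S := by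
    ext s
    constructor
    · rintro ⟨i, hi, rfl⟩
      simp only [hTdef, Finset.coe_filter, Set.mem_ofPred_eq] at hi
      exact hi.2
    · intro hs
      obtain ⟨i, hi, rfl⟩ := hsub hs
      refine ⟨i, ?_, rfl⟩
      simp only [hTdef, Finset.coe_filter, Finset.mem_range, Set.mem_ofPred_eq]
      exact ⟨by omega, hs⟩
  have hTcard : T.card = m := by
    rw [← hS, ← himg, hinj.ncard_image, Set.ncard_coe_finset]
  have hTne : T.Nonempty := Finset.card_pos.1 (by omega)
  set t := T.min' hTne with ht
  set t' := T.max' hTne with ht'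
  have hmin : ∀ i ∈ T, t ≤ i := fun i hi => T.min'_le i hi
  have hmax : ∀ i ∈ T, i ≤ t' := fun i hi => T.le_max' i hi
  have htT : t ∈ T := T.min'_mem hTne
  have htT' : t' ∈ T := T.max'_mem hTne
  have hlt' : t' < m + 3 := Finset.mem_range.1 (Finset.mem_filter.1 htT').1
  have hsubinj : Set.InjOn (fun i : ℕ => i - t) T := by
    intro a ha b hb hab
    have := hmin a ha
    have := hmin b hb
    simp only at hab
    omega
  have hM : t' - t ≤ m := by
    refine hP.hull_le hS hfree (T := T.image (· - t)) (y := y + t * d) (d := d) hd ?_ ?_ ?_ ?_ ?_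
      (by omega)
    · intro i hi
      obtain ⟨a, ha, rfl⟩ := Finset.mem_image.1 hi
      have h1 := (Finset.mem_filter.1 ha).2
      rw [Nat.cast_sub (hmin a ha)]
      convert h1 using 1
      ring
    · intro i hi
      obtain ⟨a, ha, rfl⟩ := Finset.mem_image.1 hi
      have := hmax a ha
      exact Finset.mem_range.2 (by omega)
    · rw [Finset.card_image_of_injOn hsubinj, hTcard]
    · exact Finset.mem_image.2 ⟨t, htT, by omega⟩
    · exact Finset.mem_image.2 ⟨t', htT', rfl⟩
  refine ⟨y + t * d, d, hd, fun s hs => ?_⟩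
  rw [← himg] at hs
  obtain ⟨i, hi, rfl⟩ := hs
  have h1 := hmin i hi
  have h2 := hmax i hi
  refine ⟨i - t, by omega, ?_⟩
  rw [Nat.cast_sub h1]
  ring

end Support

section Model

variable {p n' : ℕ}

theorem mem_Ival_neg {y x : ZMod p} {t : ℕ} (hx : x ∈ Ival y t) :
    -x ∈ Ival (-y - (t : ZMod p)) t := by
  obtain ⟨i, hi, rfl⟩ := hx
  exact ⟨t - i, by omega, by rw [Nat.cast_sub hi]; ring⟩

/-- Scaling the first coordinate of the model space. -/
def dilate [Fact p.Prime] (c : ZMod p) (hc : c ≠ 0) :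
    (ZMod p × (Fin n' → ZMod p)) ≃+ (ZMod p × (Fin n' → ZMod p)) where
  toFun x := (c * x.1, x.2)
  invFun x := (c⁻¹ * x.1, x.2)
  left_inv x := by simp [hc]
  right_inv x := by simp [hc]
  map_add' x y := by simp [mul_add]

/-- Shearing the model space along the first coordinate. -/
def shear (s : Fin n' → ZMod p) :
    (ZMod p × (Fin n' → ZMod p)) ≃+ (ZMod p × (Fin n' → ZMod p)) where
  toFun x := (x.1, x.2 - x.1 • s)
  invFun x := (x.1, x.2 + x.1 • s)
  left_inv x := by simp
  right_inv x := by simp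
  map_add' x y := by
    ext1
    · simp
    · simp only [Prod.snd_add, Prod.fst_add, add_smul]; abel

/-- The fibre of `B` above `i`. -/
def fiber (B : Set (ZMod p × (Fin n' → ZMod p))) (i : ZMod p) : Set (Fin n' → ZMod p) :=
  {w | (i, w) ∈ B}

/-- Triviality or normality for subsets of the model space `F_p × F_p^{n'}`. -/
def IsTrivialOrNormal (k l m lam p n' : ℕ) (B : Set (ZMod p × (Fin n' → ZMod p))) : Prop :=
  ∃ e : (ZMod p × (Fin n' → ZMod p)) ≃+ (ZMod p × (Fin n' → ZMod p)),
    (∃ j, j < (lam + 2) / 2 ∧ e '' B ⊆ cub p n' (ajElt k l m p j) m) ∨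
    (B.ncard = m * p ^ n' ∧ ∃ a : ZMod p,
      ((l : ZMod p) * a - (k : ZMod p) * (a + (m : ZMod p) - 1) ∈ Ival (1 : ZMod p) (l - 1) ∨
        (lam + l + 2 ≤ k ∧
          (l : ZMod p) * a - (k : ZMod p) * (a + (m : ZMod p) - 1) ∈
            Ival ((lam + l + 2 : ℕ) : ZMod p) (k - (lam + l + 2)))) ∧
      e '' B = cub p n' a (m - 1)) ∨
    (l = 1 ∧ B.ncard = m * p ^ n' ∧ ∃ V : Submodule (ZMod p) (Fin n' → ZMod p), V ≠ ⊤ ∧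
      e '' B =
        ({type2a k l m p} ×ˢ (Set.univ \ (V : Set (Fin n' → ZMod p)))) ∪
          ((Ival (type2a k l m p + 1) (m - 2)) ×ˢ (Set.univ : Set (Fin n' → ZMod p))) ∪
          ({type2a k l m p + (m : ZMod p)} ×ˢ (V : Set (Fin n' → ZMod p))))

variable {k l m lam : ℕ} {B : Set (ZMod p × (Fin n' → ZMod p))}

theorem IsTrivialOrNormal.of_image
    (f : (ZMod p × (Fin n' → ZMod p)) ≃+ (ZMod p × (Fin n' → ZMod p)))
    (h : IsTrivialOrNormal k l m lam p n' (f '' B)) : IsTrivialOrNormal k l m lam p n' B := by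
  obtain ⟨e, he⟩ := h
  have him : (f.trans e) '' B = e '' (f '' B) := by
    rw [← Set.image_comp]; rfl
  refine ⟨f.trans e, ?_⟩
  rw [him]
  rwa [Set.ncard_image_of_injective B f.injective] at he

theorem KLParams.sub_ne_zero (P : KLParams k l m lam p) : ((k - l : ℕ) : ZMod p) ≠ 0 := by
  obtain ⟨hlk, hl, hkl, hlam, hp, hpp, hm7, hmkl⟩ := P
  rw [Ne, ZMod.natCast_eq_zero_iff]
  intro h
  have := Nat.le_of_dvd (by omega) h
  have : k + l ≤ (k + l) * m := Nat.le_mul_of_pos_right _ (by omega)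
  omega

theorem KLParams.cast_eq_zero (P : KLParams k l m lam p) :
    ((k : ZMod p) + l) * m + 2 + lam = 0 := by
  have h : ((p : ℕ) : ZMod p) = 0 := ZMod.natCast_self p
  rw [P.hp] at h
  have h2 : (((k + l) * m + 2 + lam : ℕ) : ZMod p) = 0 := by rw [← P.hp] at h ⊢; exact h
  push_cast at h2
  exact h2

theorem KLParams.five_mul_lt (P : KLParams k l m lam p) : 5 * m < p := by
  have := Nat.mul_le_mul_right m P.hkl
  have := P.hp
  omega

theorem KLParams.eq_ajElt (P : KLParams k l m lam p) {y : ZMod p} {j : ℕ}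
    (hy : (l : ZMod p) * y = k * y + (k * m + 1 + j : ℕ)) : y = ajElt k l m p j := by
  have : Fact p.Prime := ⟨P.hpp⟩
  rw [ajElt, eq_mul_inv_iff_mul_eq₀ P.sub_ne_zero, Nat.cast_sub P.hlk.le]
  linear_combination -hy

/-- Sets whose support lies in a sum-free interval of length `m + 1` are trivial. -/
theorem KLParams.trivial_of_interval (P : KLParams k l m lam p) {y : ZMod p} {j : ℕ}
    (hj : j ≤ lam) (hy : (l : ZMod p) * y = k * y + (k * m + 1 + j : ℕ))
    (hB : ∀ b ∈ B, b.1 ∈ Ival y m) : IsTrivialOrNormal k l m lam p n' B := by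
  have : Fact p.Prime := ⟨P.hpp⟩
  by_cases h : j < (lam + 2) / 2
  · refine ⟨AddEquiv.refl _, Or.inl ⟨j, h, ?_⟩⟩
    rintro _ ⟨b, hb, rfl⟩
    rw [← P.eq_ajElt hy]
    exact hB b hb
  · refine ⟨dilate (-1) (neg_ne_zero.2 one_ne_zero), Or.inl ⟨lam - j, by omega, ?_⟩⟩
    rintro _ ⟨b, hb, rfl⟩
    have hy' : (l : ZMod p) * (-y - m) = k * (-y - m) + (k * m + 1 + (lam - j) : ℕ) := by
      push_cast [Nat.cast_sub hj] at hy ⊢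
      linear_combination -hy - P.cast_eq_zero
    rw [← P.eq_ajElt hy']
    have := mem_Ival_neg (hB b hb)
    simpa [cub, dilate] using this

theorem KLParams.type1_of_interval (P : KLParams k l m lam p) {y : ZMod p}
    (hB : B = cub p n' y (m - 1)) (hcard : B.ncard = m * p ^ n')
    (hfree : KLFree k l (Ival y (m - 1))) : IsTrivialOrNormal k l m lam p n' B := by
  have : Fact p.Prime := ⟨P.hpp⟩
  have hP := P
  obtain ⟨hlk, hl, hkl, hlam, hp, hpp, hm7, hmkl⟩ := P
  have hIv : ∀ i : ℕ, i ≤ m - 1 → y + i ∈ Ival y (m - 1) := fun i hi => ⟨i, hi, rfl⟩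
  obtain ⟨v, hv1, hv2, hv⟩ := chain_avoids (F := itSum k (Ival y (m - 1)))
    (Y := itSum l (Ival y (m - 1))) (fun x hx => hfree.disjoint hx) (α := k * y) (β := l * y)
    (a := k * (m - 1) + 1) (r := l) (δ := m - 1)
    (fun i hi => itSum_interval hIv k i (by omega))
    (fun i hi => itSum_interval hIv l _ (Nat.mul_le_mul_right _ hi)) (by nlinarith)
  obtain ⟨x, rfl⟩ : ∃ x, v = k * (m - 1) + x := Nat.exists_eq_add_of_le (by omega)
  have hx1 : 1 ≤ x := by omega
  obtain ⟨m', rfl⟩ : ∃ m', m = m' + 1 := ⟨m - 1, by omega⟩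
  simp only [Nat.add_sub_cancel] at *
  have hx2 : x ≤ k + l + 1 + lam := by
    have : (k + l) * (m' + 1) = k * m' + l * m' + (k + l) := by ring
    omega
  have hp0 := hP.cast_eq_zero
  push_cast at hv hp0
  have hx : (l : ZMod p) * y - k * (y + (m' + 1 : ℕ) - 1) = x := by
    push_cast
    linear_combination hv
  have hsub : ∀ b ∈ B, b.1 ∈ Ival y m' := by rw [hB]; exact fun b hb => hb
  by_cases c1 : x ≤ l
  · refine ⟨AddEquiv.refl _, Or.inr (Or.inl ⟨hcard, y, Or.inl ?_, ?_⟩)⟩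
    · exact ⟨x - 1, by omega, by rw [hx, Nat.cast_sub hx1]; push_cast; ring⟩
    · simpa using hB
  by_cases c2 : x ≤ l + 1 + lam
  · refine hP.trivial_of_interval (y := y - 1) (j := x - 1 - l) (by omega) ?_ ?_
    · rw [Nat.sub_sub]
      push_cast [Nat.cast_sub (by omega : 1 + l ≤ x)]
      linear_combination hv
    · intro b hb
      obtain ⟨i, hi, hbi⟩ := hsub b hb
      exact ⟨i + 1, by omega, by rw [hbi]; push_cast; ring⟩
  by_cases c3 : x ≤ k
  · refine ⟨AddEquiv.refl _, Or.inr (Or.inl ⟨hcard, y, Or.inr ⟨by omega, ?_⟩, ?_⟩)⟩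
    · exact ⟨x - (lam + l + 2), by omega, by
        rw [hx, Nat.cast_sub (by omega)]; push_cast; ring⟩
    · simpa using hB
  by_cases c4 : x ≤ k + 1 + lam
  · refine hP.trivial_of_interval (y := y) (j := x - 1 - k) (by omega) ?_ ?_
    · rw [Nat.sub_sub]
      push_cast [Nat.cast_sub (by omega : 1 + k ≤ x)]
      linear_combination hv
    · intro b hb
      obtain ⟨i, hi, hbi⟩ := hsub b hb
      exact ⟨i, by omega, hbi⟩
  · refine ⟨dilate (-1) (neg_ne_zero.2 one_ne_zero),
      Or.inr (Or.inl ⟨hcard, -y - m', Or.inl ?_, ?_⟩)⟩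
    · refine ⟨k + l + 1 + lam - x, by omega, ?_⟩
      push_cast [Nat.cast_sub hx2]
      linear_combination -hv - hp0
    · ext b
      constructor
      · rintro ⟨b, hb, rfl⟩
        have := mem_Ival_neg (hsub b hb)
        simpa [cub, dilate] using this
      · intro hb
        refine ⟨(-b.1, b.2), ?_, by simp [dilate]⟩
        rw [hB]
        have := mem_Ival_neg (show b.1 ∈ Ival (-y - (m' : ZMod p)) m' from hb)
        simpa [cub] using this

/-- If `S` is an interval of length `m + 1` with an interior point removed and `S` is
`(k,ℓ)`-sum-free, then so is the whole interval. -/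
theorem KLParams.position_of_gap (P : KLParams k l m lam p) {S : Set (ZMod p)} {y : ZMod p}
    {g : ℕ} (hg : 0 < g) (hgm : g < m) (hS : ∀ i : ℕ, i ≤ m → i ≠ g → y + i ∈ S)
    (hfree : KLFree k l S) :
    ∃ j ≤ lam, (l : ZMod p) * y = k * y + (k * m + 1 + j : ℕ) := by
  have : Fact p.Prime := ⟨P.hpp⟩
  have hp0 := P.cast_eq_zero
  obtain ⟨hlk, hl, hkl, hlam, hp, hpp, hm7, hmkl⟩ := P
  have hy : y ∈ S := by simpa using hS 0 (by omega) (by omega)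
  have hym : y + m ∈ S := hS m le_rfl (by omega)
  have hends := nsmul_add_mul_mem_itSum hy hym
  have hk : ∀ z : ℕ, 2 ≤ z → z ≤ k * m - 2 → (k * y + z : ZMod p) ∈ itSum k S := by
    intro z hz hz'
    have e : k = 2 + (k - 2) := by omega
    have := interval_add_itSum (gap_add_gap hg hgm hS) hy hym (by omega) (k - 2) z hz (by
      have : k * m = 2 * m + (k - 2) * m := by rw [← add_mul, ← e]
      omega)
    rw [← itSum_two, ← itSum_add, ← e] at this
    convert this using 1
    push_cast [Nat.cast_sub (by omega : 2 ≤ k)]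
    ring
  have hone : ∀ q i z : ℕ, z ≤ m → z ≠ g → i + 1 ≤ q →
      (q * y + (i * m + z : ℕ) : ZMod p) ∈ itSum q S := by
    intro q i z hz hzg hi
    have := Set.add_mem_add (hends (q - 1) i (by omega)) (hS z hz hzg)
    rw [← itSum_succ, Nat.sub_add_cancel (by omega)] at this
    convert this using 1
    push_cast [Nat.cast_sub (by omega : 1 ≤ q)]
    ring
  have hkm : 3 * m ≤ k * m := Nat.mul_le_mul_right m (by omega)
  obtain ⟨v, hv1, hv2, hv⟩ := chain_avoids (F := itSum k S) (Y := itSum l S)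
    (fun x hx => hfree.disjoint hx) (α := k * y + 2) (β := l * y)
    (a := k * m - 3) (r := l) (δ := m)
    (fun i hi => by
      have := hk (i + 2) (by omega) (by omega)
      convert this using 1; push_cast; ring)
    (fun i hi => hends l i hi) (by omega)
  rw [add_mul] at hp
  obtain ⟨x, rfl⟩ : ∃ x, v = k * m - 3 + x := Nat.exists_eq_add_of_le hv1
  have hv' : (l : ZMod p) * y + 1 = k * y + k * m + x := by
    rw [hv]; push_cast [Nat.cast_sub (by omega : 3 ≤ k * m)]; ring
  have hx0 : x ≠ 0 := by
    rintro rfl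
    by_cases h : g = m - 1
    · refine hfree.disjoint (hends k k le_rfl) ?_
      have := hone l 0 1 (by omega) (by omega) hl
      convert this using 1
      push_cast at hv' ⊢
      linear_combination -hv'
    · refine hfree.disjoint (hone k (k - 1) (m - 1) (by omega) (by omega) (by omega)) ?_
      have := hends l 0 (by omega)
      convert this using 1
      push_cast [Nat.cast_sub (by omega : 1 ≤ k), Nat.cast_sub (by omega : 1 ≤ m)] at hv' ⊢
      linear_combination -hv'
  have hx1 : x ≠ 1 := by
    rintro rfl
    refine hfree.disjoint (hends k k le_rfl) ?_
    have := hends l 0 (by omega)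
    convert this using 1
    push_cast at hv' ⊢
    linear_combination -hv'
  have hx2 : x ≠ lam + 3 := by
    rintro rfl
    refine hfree.disjoint (hends k 0 (by omega)) ?_
    have := hends l l le_rfl
    convert this using 1
    push_cast at hv' ⊢
    linear_combination -hv' - hp0
  have hx3 : x ≠ lam + 4 := by
    rintro rfl
    by_cases h : g = 1
    · refine hfree.disjoint (hends k 0 (by omega)) ?_
      have := hone l (l - 1) (m - 1) (by omega) (by omega) (by omega)
      convert this using 1
      push_cast [Nat.cast_sub hl, Nat.cast_sub (by omega : 1 ≤ m)] at hv' ⊢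
      linear_combination -hv' - hp0
    · refine hfree.disjoint (hone k 0 1 (by omega) (by omega) (by omega)) ?_
      have := hends l l le_rfl
      convert this using 1
      push_cast at hv' ⊢
      linear_combination -hv' - hp0
  refine ⟨x - 2, by omega, ?_⟩
  push_cast [Nat.cast_sub (by omega : 2 ≤ x)]
  linear_combination hv'

theorem card_fibre_space [Fact p.Prime] : Nat.card (Fin n' → ZMod p) = p ^ n' := by
  simp

theorem ncard_prod_univ [Fact p.Prime] (S : Set (ZMod p)) :
    (S ×ˢ (Set.univ : Set (Fin n' → ZMod p))).ncard = S.ncard * p ^ n' := by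
  rw [Set.ncard_prod, Set.ncard_univ, card_fibre_space]

end Model

section NearlyFull

variable {p n' k l m lam : ℕ} {B : Set (ZMod p × (Fin n' → ZMod p))} {u y : ZMod p}

theorem exists_add_eq_of_card_lt {W : Type*} [AddCommGroup W] [Finite W] {X Y : Set W}
    (h : Nat.card W < X.ncard + Y.ncard) (w : W) : ∃ x ∈ X, ∃ y ∈ Y, x + y = w := by
  by_contra! hcon
  have hinj : Function.Injective (fun y : W => w - y) := sub_right_injective
  have := ncard_add_ncard_le_of_disjoint (X := X) (Y := (fun y : W => w - y) '' Y) (by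
    rintro x hx ⟨y, hy, rfl⟩
    exact hcon _ hx y hy (sub_add_cancel w y))
  rw [Set.ncard_image_of_injective _ hinj] at this
  omega

theorem exists_mem_itSum_of_fst {j : ℕ} {s : ZMod p} (hs : s ∈ itSum j (Prod.fst '' B)) :
    ∃ w, (s, w) ∈ itSum j B := by
  have := itSum_image (AddMonoidHom.fst (ZMod p) (Fin n' → ZMod p)) B j
  rw [AddMonoidHom.coe_fst] at this
  rw [this] at hs
  obtain ⟨b, hb, rfl⟩ := hs
  exact ⟨b.2, hb⟩

theorem nsmul_mem_itSum_fiber {j : ℕ} {i : ZMod p} {w : Fin n' → ZMod p}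
    (hw : w ∈ itSum j (fiber B i)) : ((j * i : ZMod p), w) ∈ itSum j B := by
  induction j generalizing w with
  | zero => obtain rfl : w = 0 := hw; simp [itSum]
  | succ j ih =>
    obtain ⟨a, ha, b, hb, rfl⟩ := Set.mem_add.1 hw
    refine Set.mem_add.2 ⟨_, ih ha, (i, b), hb, ?_⟩
    ext1
    · simp; ring
    · simp

/-- `B` has support of size `m + 1` and all of its fibres, except possibly the one above `u`,
contain more than half of the space. -/
structure NearlyFull (k l m p n' : ℕ) (B : Set (ZMod p × (Fin n' → ZMod p))) (u : ZMod p) :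
    Prop where
  free : KLFree k l B
  card : m * p ^ n' ≤ B.ncard
  supp : (Prod.fst '' B).ncard = m + 1
  mem : u ∈ Prod.fst '' B
  big : ∀ i ∈ Prod.fst '' B, i ≠ u → p ^ n' < 2 * (fiber B i).ncard

theorem fst_image_dilate [Fact p.Prime] {c : ZMod p} (hc : c ≠ 0) :
    Prod.fst '' (dilate (n' := n') c hc '' B) = (fun x => c * x) '' (Prod.fst '' B) := by
  rw [← Set.image_comp, ← Set.image_comp]; rfl

theorem fiber_image_dilate [Fact p.Prime] {c : ZMod p} (hc : c ≠ 0) (i : ZMod p) :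
    fiber (dilate (n' := n') c hc '' B) (c * i) = fiber B i := by
  ext w
  constructor
  · rintro ⟨b, hb, hbw⟩
    have h1 : c * b.1 = c * i := congrArg Prod.fst hbw
    have h2 : b.2 = w := congrArg Prod.snd hbw
    have h3 := mul_left_cancel₀ hc h1
    rw [← h2, ← h3]
    exact hb
  · intro hw
    exact ⟨(i, w), hw, rfl⟩

theorem NearlyFull.image_dilate [Fact p.Prime] (h : NearlyFull k l m p n' B u) {c : ZMod p}
    (hc : c ≠ 0) : NearlyFull k l m p n' (dilate c hc '' B) (c * u) where
  free := h.free.image_equiv _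
  card := by rw [Set.ncard_image_of_injective _ (dilate c hc).injective]; exact h.card
  supp := by
    rw [fst_image_dilate, Set.ncard_image_of_injective _ (mul_right_injective₀ hc), h.supp]
  mem := by rw [fst_image_dilate]; exact ⟨u, h.mem, rfl⟩
  big := by
    rw [fst_image_dilate]
    rintro _ ⟨i, hi, rfl⟩ hne
    rw [fiber_image_dilate]
    exact h.big i hi fun hiu => hne (by rw [hiu])

theorem NearlyFull.mem_itSum [Fact p.Prime] (h : NearlyFull k l m p n' B u) {j : ℕ}
    (hj : 2 ≤ j) {s : ZMod p}
    (hs : s ∈ Prod.fst '' B \ {u} + Prod.fst '' B \ {u} + itSum (j - 2) (Prod.fst '' B))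
    (w : Fin n' → ZMod p) : (s, w) ∈ itSum j B := by
  obtain ⟨_, ⟨a, ha, b, hb, rfl⟩, c, hc, rfl⟩ := hs
  obtain ⟨w', hw'⟩ := exists_mem_itSum_of_fst hc
  have h1 := h.big a ha.1 ha.2
  have h2 := h.big b hb.1 hb.2
  obtain ⟨x, hx, y, hy, hxy⟩ := exists_add_eq_of_card_lt (X := fiber B a) (Y := fiber B b)
    (by rw [card_fibre_space]; omega) (w - w')
  have := Set.add_mem_add
    (Set.add_mem_add (show (a, x) ∈ B from hx) (show (b, y) ∈ B from hy)) hw'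
  rw [← itSum_two, ← itSum_add, Nat.add_sub_cancel' hj] at this
  convert this using 1
  ext1
  · rfl
  · simp [hxy]

theorem NearlyFull.avoids [Fact p.Prime] (h : NearlyFull k l m p n' B u) (hk : 2 ≤ k) :
    ∀ s ∈ Prod.fst '' B \ {u} + Prod.fst '' B \ {u} + itSum (k - 2) (Prod.fst '' B),
      s ∉ itSum l (Prod.fst '' B) := by
  intro s hs hsl
  obtain ⟨w, hw⟩ := exists_mem_itSum_of_fst hsl
  exact h.free.disjoint (h.mem_itSum hk hs w) hw

theorem NearlyFull.free_diff [Fact p.Prime] (h : NearlyFull k l m p n' B u) (hk : 2 ≤ k) :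
    KLFree k l (Prod.fst '' B \ {u}) := by
  refine KLFree.of_disjoint fun s hs hsl =>
    h.avoids hk s ?_ (itSum_mono Set.sdiff_subset l hsl)
  rw [← Nat.add_sub_cancel' hk, itSum_add, itSum_two] at hs
  exact Set.add_subset_add subset_rfl (itSum_mono Set.sdiff_subset _) hs

theorem subset_fibers (B : Set (ZMod p × (Fin n' → ZMod p))) (i j : ZMod p) :
    B ⊆ ({i} ×ˢ fiber B i ∪ {j} ×ˢ fiber B j) ∪
      ((Prod.fst '' B \ {i, j}) ×ˢ (Set.univ : Set (Fin n' → ZMod p))) := by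
  intro b hb
  by_cases h1 : b.1 = i
  · exact Or.inl (Or.inl ⟨h1, by rw [← h1]; exact hb⟩)
  by_cases h2 : b.1 = j
  · exact Or.inl (Or.inr ⟨h2, by rw [← h2]; exact hb⟩)
  · exact Or.inr ⟨⟨⟨b, hb, rfl⟩, by simp [h1, h2]⟩, trivial⟩

theorem ncard_fibers_le [Fact p.Prime] (hm : 1 ≤ m) (hsupp : (Prod.fst '' B).ncard = m + 1)
    {i j : ZMod p} (hi : i ∈ Prod.fst '' B) (hj : j ∈ Prod.fst '' B) (hij : i ≠ j) :
    (({i} ×ˢ fiber B i ∪ {j} ×ˢ fiber B j) ∪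
      ((Prod.fst '' B \ {i, j}) ×ˢ (Set.univ : Set (Fin n' → ZMod p)))).ncard ≤
      (fiber B i).ncard + (fiber B j).ncard + (m - 1) * p ^ n' := by
  refine (Set.ncard_union_le _ _).trans (Nat.add_le_add ?_ ?_)
  · refine (Set.ncard_union_le _ _).trans ?_
    simp [Set.ncard_prod]
  · rw [ncard_prod_univ, Set.ncard_sdiff (by
      rintro x (rfl | rfl) <;> assumption), hsupp, Set.ncard_pair hij]
    exact Nat.mul_le_mul_right _ (by omega)

theorem ncard_fiber_add_ge [Fact p.Prime] (hm : 1 ≤ m) (hcard : m * p ^ n' ≤ B.ncard)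
    (hsupp : (Prod.fst '' B).ncard = m + 1) {i j : ZMod p} (hi : i ∈ Prod.fst '' B)
    (hj : j ∈ Prod.fst '' B) (hij : i ≠ j) :
    p ^ n' ≤ (fiber B i).ncard + (fiber B j).ncard := by
  have h1 := Set.ncard_le_ncard (subset_fibers B i j)
  have h2 := ncard_fibers_le hm hsupp hi hj hij
  obtain ⟨c, rfl⟩ := Nat.exists_eq_add_of_le' hm
  rw [Nat.add_sub_cancel] at h2
  rw [add_mul, one_mul] at hcard
  omega

theorem eq_fibers_of_card [Fact p.Prime] (hm : 1 ≤ m) (hcard : m * p ^ n' ≤ B.ncard)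
    (hsupp : (Prod.fst '' B).ncard = m + 1) {i j : ZMod p} (hi : i ∈ Prod.fst '' B)
    (hj : j ∈ Prod.fst '' B) (hij : i ≠ j)
    (h : (fiber B i).ncard + (fiber B j).ncard ≤ p ^ n') :
    B.ncard = m * p ^ n' ∧ B = ({i} ×ˢ fiber B i ∪ {j} ×ˢ fiber B j) ∪
      ((Prod.fst '' B \ {i, j}) ×ˢ (Set.univ : Set (Fin n' → ZMod p))) := by
  have h1 := Set.ncard_le_ncard (subset_fibers B i j)
  have h2 := ncard_fibers_le hm hsupp hi hj hij
  have h3 : m * p ^ n' = (m - 1) * p ^ n' + p ^ n' := by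
    conv_lhs => rw [← Nat.sub_add_cancel hm, add_mul, one_mul]
  exact ⟨by omega, Set.eq_of_subset_of_ncard_le (subset_fibers B i j) (by omega)⟩

/-- A finite set `X` in a vector space over `F_p` with `|X + X| ≤ |X|` is a coset of a
subspace. -/
theorem exists_submodule_of_ncard_add_le [Fact p.Prime] {X : Set (Fin n' → ZMod p)}
    {w : Fin n' → ZMod p} (hw : w ∈ X) (hX : (X + X).ncard ≤ X.ncard) :
    ∃ V : Submodule (ZMod p) (Fin n' → ZMod p), ∀ x, x ∈ X ↔ x - w ∈ V := by
  have heq : (fun x => x + w) '' X = X + X := by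
    refine Set.eq_of_subset_of_ncard_le ?_ ?_
    · rintro _ ⟨x, hx, rfl⟩
      exact Set.add_mem_add hx hw
    · rwa [Set.ncard_image_of_injective _ (add_left_injective w)]
  have hadd : ∀ a b, a + w ∈ X → b + w ∈ X → a + b + w ∈ X := by
    intro a b ha hb
    have := Set.add_mem_add ha hb
    rw [← heq] at this
    obtain ⟨x, hx, hxe⟩ := this
    have hx' : x = a + b + w := by
      have : x + w = (a + b + w) + w := by rw [show x + w = _ from hxe]; abel
      exact add_right_cancel this
    rwa [← hx']
  have hnsmul : ∀ (c : ℕ) a, a + w ∈ X → c • a + w ∈ X := by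
    intro c a ha
    induction c with
    | zero => simpa using hw
    | succ c ih => rw [succ_nsmul]; exact hadd _ _ ih ha
  refine ⟨{ carrier := {x | x + w ∈ X}
            add_mem' := fun {a b} ha hb => hadd a b ha hb
            zero_mem' := by simpa using hw
            smul_mem' := fun c a ha => ?_ }, fun x => ?_⟩
  · have := hnsmul c.val a ha
    rw [← Nat.cast_smul_eq_nsmul (ZMod p), ZMod.natCast_zmod_val] at this
    exact this
  · change x ∈ X ↔ x - w + w ∈ X
    rw [sub_add_cancel]

/-- The extremal configuration in which the fibre above one end of the interval is a coset of a
subspace. -/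
theorem KLParams.type2_of_fibers (P : KLParams k l m lam p) (hl : l = 1)
    (h : NearlyFull k l m p n' B u) (hS : Prod.fst '' B = Ival y m) (hu : u = y + m)
    (hy : y = k * u) : IsTrivialOrNormal k l m lam p n' B := by
  have : Fact p.Prime := ⟨P.hpp⟩
  have h5 := P.five_mul_lt
  have hP := P
  obtain ⟨hlk, -, hkl, hlam, hp, hpp, hm7, hmkl⟩ := P
  have hm0 : (m : ZMod p) ≠ 0 := by
    rw [Ne, ZMod.natCast_eq_zero_iff]
    exact fun hd => absurd (Nat.le_of_dvd (by omega) hd) (by omega)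
  have hyu : y ≠ u := by rw [hu]; simpa using hm0
  have hyS : y ∈ Prod.fst '' B := by rw [hS]; exact ⟨0, by omega, by simp⟩
  have hu0 : u ≠ 0 := by
    rintro rfl
    exact hyu (by rw [hy, mul_zero])
  obtain ⟨w, hwu⟩ : ∃ w, w ∈ fiber B u := by
    obtain ⟨⟨_, w⟩, hw, rfl⟩ := h.mem
    exact ⟨w, hw⟩
  have hdisj : ∀ x ∈ itSum k (fiber B u), x ∉ fiber B y := by
    intro x hx hxy
    have h1 := nsmul_mem_itSum_fiber hx
    rw [← hy] at h1
    refine h.free.disjoint h1 ?_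
    rw [hl, itSum_one]
    exact hxy
  have hge := ncard_fiber_add_ge (by omega) h.card h.supp hyS h.mem hyu
  have hsumset : (fiber B u + fiber B u).ncard ≤ (fiber B u).ncard := by
    have hle : (fiber B u + fiber B u).ncard ≤ (itSum k (fiber B u)).ncard := by
      rw [← Set.ncard_image_of_injective _ (add_left_injective ((k - 2) • w))]
      refine Set.ncard_le_ncard ?_
      rintro _ ⟨x, hx, rfl⟩
      rw [← Nat.add_sub_cancel' (by omega : 2 ≤ k), itSum_add, itSum_two]
      exact Set.add_mem_add hx (by
        rw [Nat.add_sub_cancel' (by omega : 2 ≤ k)]; exact nsmul_mem_itSum hwu _)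
    have := ncard_add_ncard_le_of_disjoint hdisj
    rw [card_fibre_space] at this
    omega
  obtain ⟨V, hV⟩ := exists_submodule_of_ncard_add_le hwu hsumset
  have hcoset : ∀ x, x - (k : ZMod p) • w ∈ V → x ∉ fiber B y := by
    intro x hx
    refine hdisj x ?_
    have h1 : x - (k - 1) • w ∈ fiber B u := by
      rw [hV]
      convert hx using 1
      rw [← Nat.cast_smul_eq_nsmul (ZMod p), sub_sub]
      push_cast [Nat.cast_sub (by omega : 1 ≤ k)]
      module
    have := Set.add_mem_add (nsmul_mem_itSum hwu (k - 1)) h1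
    rw [← itSum_succ, Nat.sub_add_cancel (by omega), add_sub_cancel] at this
    exact this
  have hVcard : (fiber B u).ncard = {x | x - (k : ZMod p) • w ∈ V}.ncard := by
    rw [← Set.ncard_image_of_injective (fiber B u)
      (add_left_injective ((k : ZMod p) • w - w))]
    congr 1
    ext x
    constructor
    · rintro ⟨z, hz, rfl⟩
      rw [hV] at hz
      change z + ((k : ZMod p) • w - w) - (k : ZMod p) • w ∈ V
      convert hz using 1
      abel
    · intro hx
      refine ⟨x - ((k : ZMod p) • w - w), ?_, sub_add_cancel _ _⟩
      rw [hV]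
      convert (show x - (k : ZMod p) • w ∈ V from hx) using 1
      abel
  have hcomp : fiber B y = {x | x - (k : ZMod p) • w ∈ V}ᶜ := by
    refine Set.eq_of_subset_of_ncard_le (fun x hx hx' => hcoset x hx' hx) ?_
    have := Set.ncard_add_ncard_compl {x | x - (k : ZMod p) • w ∈ V}
    rw [card_fibre_space] at this
    omega
  obtain ⟨hBcard, hBeq⟩ := eq_fibers_of_card (by omega) h.card h.supp hyS h.mem hyu (by
    have := ncard_add_ncard_le_of_disjoint (X := {x | x - (k : ZMod p) • w ∈ V}) hcoset
    rw [card_fibre_space] at this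
    omega)
  have ha : type2a k l m p = y := by
    have hkl0 : (l : ZMod p) - k ≠ 0 := by
      have := hP.sub_ne_zero
      rw [Nat.cast_sub hlk.le] at this
      exact fun h0 => this (by linear_combination -h0)
    rw [type2a, mul_inv_eq_iff_eq_mul₀ hkl0, hl]
    rw [hu] at hy
    push_cast
    linear_combination -hy
  refine ⟨shear (u⁻¹ • w), Or.inr (Or.inr ⟨hl, hBcard, V, ?_, ?_⟩)⟩
  · rintro rfl
    obtain ⟨b, hb, hby⟩ := hyS
    have : b.2 ∈ fiber B y := by rw [← hby]; exact hb
    rw [hcomp] at this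
    exact this (by simp)
  · have hmem : ∀ b, b ∈ B ↔ (b.1 = y ∧ b.2 - (k : ZMod p) • w ∉ V) ∨
        (b.1 = u ∧ b.2 - w ∈ V) ∨ b.1 ∈ Ival (y + 1) (m - 2) := by
      intro b
      have hmid : b.1 ∈ Prod.fst '' B \ {y, u} ↔ b.1 ∈ Ival (y + 1) (m - 2) := by
        rw [hS]
        constructor
        · rintro ⟨⟨i, hi, hbi⟩, hne⟩
          have h1 : i ≠ 0 := by
            rintro rfl; exact hne (Or.inl (by simpa using hbi))
          have h2 : i ≠ m := by
            rintro rfl; exact hne (Or.inr (by rw [hbi, hu]; rfl))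
          exact ⟨i - 1, by omega, by
            rw [hbi]; push_cast [Nat.cast_sub (by omega : 1 ≤ i)]; ring⟩
        · rintro ⟨i, hi, hbi⟩
          refine ⟨⟨i + 1, by omega, by rw [hbi]; push_cast; ring⟩, ?_⟩
          rintro (h0 | h0)
          · have : ((i + 1 : ℕ) : ZMod p) = (0 : ℕ) := by
              push_cast; rw [hbi] at h0; linear_combination h0
            rw [ZMod.natCast_eq_natCast_iff', Nat.mod_eq_of_lt (by omega),
              Nat.mod_eq_of_lt (by omega)] at this
            omega
          · have : ((i + 1 : ℕ) : ZMod p) = (m : ℕ) := by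
              rw [Set.mem_singleton_iff] at h0
              push_cast; rw [hbi, hu] at h0; linear_combination h0
            rw [ZMod.natCast_eq_natCast_iff', Nat.mod_eq_of_lt (by omega),
              Nat.mod_eq_of_lt (by omega)] at this
            omega
      conv_lhs => rw [hBeq]
      rw [Set.mem_union, Set.mem_union, Set.mem_prod, Set.mem_prod, Set.mem_prod, hmid,
        Set.mem_singleton_iff, Set.mem_singleton_iff, hV, hcomp, or_assoc]
      simp only [Set.mem_univ, and_true]
      rfl
    have hs1 : y • u⁻¹ • w = (k : ZMod p) • w := by
      rw [smul_smul, hy, mul_assoc, mul_inv_cancel₀ hu0, mul_one]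
    have hs2 : u • u⁻¹ • w = w := by rw [smul_smul, mul_inv_cancel₀ hu0, one_smul]
    have himg : ∀ b : ZMod p × (Fin n' → ZMod p), b ∈ shear (u⁻¹ • w) '' B ↔
        (b.1, b.2 + b.1 • u⁻¹ • w) ∈ B := by
      intro b
      constructor
      · rintro ⟨c, hc, rfl⟩
        simpa [shear] using hc
      · intro hb
        exact ⟨_, hb, by simp [shear]⟩
    ext b
    rw [himg, hmem, ha, ← hu]
    simp only [Set.mem_union, Set.mem_prod, Set.mem_singleton_iff, Set.mem_univ, and_true,
      Set.mem_sdiff, true_and, SetLike.mem_coe]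
    constructor
    · rintro (⟨h1, h2⟩ | ⟨h1, h2⟩ | h1)
      · left; left; refine ⟨h1, ?_⟩
        rw [h1, hs1] at h2; simpa using h2
      · right; refine ⟨h1, ?_⟩
        rw [h1, hs2] at h2; simpa using h2
      · left; right; exact h1
    · rintro ((⟨h1, h2⟩ | h1) | ⟨h1, h2⟩)
      · left; refine ⟨h1, ?_⟩
        rw [h1, hs1]; simpa using h2
      · right; right; exact h1
      · right; left; refine ⟨h1, ?_⟩
        rw [h1, hs2]; simpa using h2

end NearlyFull

section Intervals

variable {p : ℕ}

theorem exists_offset [NeZero p] {F S : Set (ZMod p)} {k l lo hi U : ℕ} {y : ZMod p}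
    (hF : ∀ x ∈ F, x ∉ itSum l S) (hI : ∀ z : ℕ, lo ≤ z → z ≤ hi → k * y + z ∈ F)
    (hy : y ∈ S) (hU : y + U ∈ S) (h : lo + U ≤ hi + 1) :
    ∃ v : ℕ, hi < v ∧ v + l * U < p + lo ∧ (l * y : ZMod p) = k * y + v := by
  obtain ⟨v, hv1, hv2, hv⟩ := chain_avoids hF (α := k * y + lo) (a := hi + 1 - lo)
    (fun i hi' => by
      have := hI (lo + i) (by omega) (by omega)
      convert this using 1; push_cast; ring)
    (fun i hi' => nsmul_add_mul_mem_itSum hy hU l i hi') (by omega)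
  exact ⟨lo + v, by omega, by omega, by rw [hv]; push_cast; ring⟩

theorem add_itSum_interval_two {X S : Set (ZMod p)} {y : ZMod p} {k lo hi U : ℕ} (hk : 2 ≤ k)
    (hX : ∀ z : ℕ, lo ≤ z → z ≤ hi → y + y + z ∈ X) (hy : y ∈ S) (hU : y + U ∈ S)
    (h : lo + U ≤ hi + 1) (z : ℕ) (hz : lo ≤ z) (hz' : z ≤ hi + (k - 2) * U) :
    k * y + z ∈ X + itSum (k - 2) S := by
  have := interval_add_itSum hX hy hU h (k - 2) z hz hz'
  convert this using 1
  push_cast [Nat.cast_sub hk]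
  ring

theorem add_itSum_interval_three {X S : Set (ZMod p)} {y : ZMod p} {k lo hi U : ℕ} (hk : 3 ≤ k)
    (hX : ∀ z : ℕ, lo ≤ z → z ≤ hi → y + y + y + z ∈ X + S) (hy : y ∈ S) (hU : y + U ∈ S)
    (h : lo + U ≤ hi + 1) (z : ℕ) (hz : lo ≤ z) (hz' : z ≤ hi + (k - 3) * U) :
    k * y + z ∈ X + itSum (k - 2) S := by
  have := interval_add_itSum hX hy hU h (k - 3) z hz hz'
  rw [add_assoc, ← congrArg (· + itSum (k - 3) S) (itSum_one S), ← itSum_add,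
    show 1 + (k - 3) = k - 2 by omega] at this
  convert this using 1
  push_cast [Nat.cast_sub hk]
  ring

theorem ncard_Ival [NeZero p] (y : ZMod p) {t : ℕ} (ht : t < p) : (Ival y t).ncard = t + 1 := by
  have : Ival y t = (fun i : ℕ => y + (i : ZMod p)) '' (Finset.range (t + 1) : Set ℕ) := by
    ext x
    constructor
    · rintro ⟨i, hi, rfl⟩
      exact ⟨i, by simpa using Nat.lt_succ_of_le hi, rfl⟩
    · rintro ⟨i, hi, rfl⟩
      exact ⟨i, by simpa [Nat.lt_succ_iff] using hi, rfl⟩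
  rw [this, Set.InjOn.ncard_image, Set.ncard_coe_finset, Finset.card_range]
  intro i hi j hj hij
  have h := add_left_cancel (show y + (i : ZMod p) = y + j from hij)
  simp only [Finset.coe_range, Set.mem_Iio] at hi hj
  rwa [ZMod.natCast_eq_natCast_iff', Nat.mod_eq_of_lt (by omega),
    Nat.mod_eq_of_lt (by omega)] at h

theorem image_neg_one_mul_Ival (y : ZMod p) (t : ℕ) :
    (fun x => -1 * x) '' Ival y t = Ival (-y - (t : ZMod p)) t := by
  ext x
  constructor
  · rintro ⟨z, hz, rfl⟩
    simpa using mem_Ival_neg hz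
  · intro hx
    exact ⟨-x, by simpa using mem_Ival_neg hx, by simp⟩

theorem exists_gap [NeZero p] {T : Set (ZMod p)} {y : ZMod p} {m : ℕ} (hmp : m < p)
    (hT : T ⊆ Ival y m) (hcard : T.ncard = m) :
    ∃ g ≤ m, y + g ∉ T ∧ ∀ i : ℕ, i ≤ m → i ≠ g → y + i ∈ T := by
  have hI := ncard_Ival y hmp
  obtain ⟨_, ⟨g, hg, rfl⟩, hgT⟩ := Set.exists_mem_notMem_of_ncard_lt_ncard
    (show T.ncard < (Ival y m).ncard by omega)
  refine ⟨g, hg, hgT, fun i hi hig => ?_⟩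
  have hsub : T ⊆ Ival y m \ {y + (g : ZMod p)} := fun x hx =>
    ⟨hT hx, fun h => hgT (by rwa [← Set.mem_singleton_iff.1 h])⟩
  have heq := Set.eq_of_subset_of_ncard_le hsub (by
    rw [Set.ncard_sdiff_singleton_of_mem (show y + (g : ZMod p) ∈ Ival y m from ⟨g, hg, rfl⟩)]
    omega)
  rw [heq]
  refine ⟨⟨i, hi, rfl⟩, fun h => hig ?_⟩
  have h := add_left_cancel (Set.mem_singleton_iff.1 h)
  rwa [ZMod.natCast_eq_natCast_iff', Nat.mod_eq_of_lt (by omega),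
    Nat.mod_eq_of_lt (by omega)] at h

theorem ncard_itSum_ge (hp : p.Prime) {S : Set (ZMod p)} {m : ℕ} (hS : m + 1 ≤ S.ncard)
    (j : ℕ) : min p (j * m + 1) ≤ (itSum j S).ncard := by
  have : NeZero p := ⟨hp.ne_zero⟩
  have hne : S.Nonempty := Set.nonempty_of_ncard_ne_zero (by omega)
  induction j with
  | zero => simp [itSum]
  | succ j ih =>
    have := ncard_add_ge hp (itSum_nonempty hne j) hne
    rw [← itSum_succ] at this
    rw [add_mul, one_mul]
    omega

end Intervals

section Classification

variable {p n' k l m lam : ℕ} {B : Set (ZMod p × (Fin n' → ZMod p))} {u y : ZMod p}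

/-- The support is an interval whose last fibre may be small. -/
theorem KLParams.of_interval_last (P : KLParams k l m lam p) (h : NearlyFull k l m p n' B u)
    (hS : Prod.fst '' B = Ival y m) (hu : u = y + m) : IsTrivialOrNormal k l m lam p n' B := by
  have : Fact p.Prime := ⟨P.hpp⟩
  have h5 := P.five_mul_lt
  have hP := P
  obtain ⟨hlk, hl, hkl, hlam, hp, hpp, hm7, hmkl⟩ := P
  have hSmem : ∀ i : ℕ, i ≤ m → y + i ∈ Prod.fst '' B := fun i hi => by
    rw [hS]; exact ⟨i, hi, rfl⟩
  have hS' : ∀ i : ℕ, i ≤ m - 1 → y + i ∈ Prod.fst '' B \ {u} := by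
    refine fun i hi => ⟨hSmem i (by omega), fun hiu => ?_⟩
    have h := add_left_cancel ((Set.mem_singleton_iff.1 hiu).trans hu)
    rw [ZMod.natCast_eq_natCast_iff', Nat.mod_eq_of_lt (by omega),
      Nat.mod_eq_of_lt (by omega)] at h
    omega
  have hy' : y ∈ Prod.fst '' B \ {u} := by simpa using hS' 0 (by omega)
  obtain ⟨c, rfl⟩ : ∃ c, k = c + 3 := ⟨k - 3, by omega⟩
  obtain ⟨v, hv1, hv2, hv⟩ := exists_offset (h.avoids (by omega))
    (add_itSum_interval_two (k := c + 3) (lo := 0) (hi := 2 * (m - 1)) (by omega)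
      (fun z _ hz => by
        have := itSum_interval hS' 2 z hz
        rw [itSum_two] at this
        convert this using 1; push_cast; ring) hy'.1 (hSmem m le_rfl) (by omega))
    hy'.1 (hSmem m le_rfl) (by omega)
  have e1 : (c + 3 - 2) * m = c * m + m := by
    rw [show c + 3 - 2 = c + 1 by omega]; ring
  have e2 : (c + 3) * m = c * m + 3 * m := by ring
  have e3 : (c + 3 + l) * m = c * m + 3 * m + l * m := by ring
  by_cases hbig : (c + 3) * m + 1 ≤ v
  · obtain ⟨j, rfl⟩ := Nat.exists_eq_add_of_le hbig
    exact hP.trivial_of_interval (by omega) hv fun b hb => hS ▸ ⟨b, hb, rfl⟩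
  rcases Nat.lt_or_ge l 2 with hl2 | hl2
  · obtain rfl : l = 1 := by omega
    obtain hv' | hv' : v = (c + 3) * m ∨ v + 1 = (c + 3) * m := by omega
    · refine hP.type2_of_fibers rfl h hS hu ?_
      rw [hv', Nat.cast_one, one_mul] at hv
      rw [hu]
      push_cast at hv ⊢
      linear_combination hv
    · exfalso
      obtain ⟨w, hw⟩ : ∃ w, w ∈ fiber B u := by
        obtain ⟨⟨_, w⟩, hw, rfl⟩ := h.mem
        exact ⟨w, hw⟩
      have h1 := h.big _ hy'.1 hy'.2
      have h2 := h.big _ (hS' (m - 1) le_rfl).1 (hS' (m - 1) le_rfl).2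
      have := ncard_add_ncard_le_of_disjoint
        (X := (fun x => (c + 2) • w + x) '' fiber B (y + (m - 1 : ℕ))) (Y := fiber B y) (by
          rintro _ ⟨x, hx, rfl⟩ hxy
          have h3 := Set.add_mem_add (nsmul_mem_itSum_fiber (nsmul_mem_itSum hw (c + 2)))
            (show (y + ((m - 1 : ℕ) : ZMod p), x) ∈ B from hx)
          rw [← itSum_succ] at h3
          refine h.free.disjoint h3 ?_
          rw [itSum_one]
          convert (show (y, (c + 2) • w + x) ∈ B from hxy) using 1
          ext1
          · have hv'' : ((v + 1 : ℕ) : ZMod p) = ((c + 3) * m : ℕ) := by rw [hv']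
            rw [hu]
            simp only [Prod.fst_add]
            push_cast [Nat.cast_sub (by omega : 1 ≤ m)] at hv hv'' ⊢
            linear_combination -hv - hv''
          · rfl)
      rw [Set.ncard_image_of_injective _ (add_right_injective _), card_fibre_space] at this
      omega
  · exfalso
    have h1 := itSum_interval (M := m) hSmem (c + 3) v (by omega)
    rw [← hv] at h1
    obtain ⟨w, hw⟩ := exists_mem_itSum_of_fst h1
    refine h.free.disjoint hw ?_
    refine h.mem_itSum hl2 ?_ w
    convert Set.add_mem_add (Set.add_mem_add hy' hy') (nsmul_mem_itSum hy'.1 (l - 2)) using 1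
    rw [nsmul_eq_mul]
    push_cast [Nat.cast_sub hl2]
    ring

/-- The support is an interval. -/
theorem KLParams.of_interval (P : KLParams k l m lam p) (h : NearlyFull k l m p n' B u)
    (hS : Prod.fst '' B = Ival y m) : IsTrivialOrNormal k l m lam p n' B := by
  have : Fact p.Prime := ⟨P.hpp⟩
  have hm := h.mem
  rw [hS] at hm
  obtain ⟨g, hg, hu⟩ := hm
  have h5 := P.five_mul_lt
  rcases Nat.eq_zero_or_pos g with rfl | hg0
  · refine IsTrivialOrNormal.of_image (dilate (-1) (neg_ne_zero.2 one_ne_zero))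
      (P.of_interval_last (y := -y - (m : ZMod p)) (h.image_dilate _) ?_ ?_)
    · rw [fst_image_dilate, hS, image_neg_one_mul_Ival]
    · rw [hu]; simp
  rcases hg.eq_or_lt with rfl | hgm
  · exact P.of_interval_last h hS hu
  have hP := P
  obtain ⟨hlk, hl, hkl, hlam, hp, hpp, hm7, hmkl⟩ := P
  have hSmem : ∀ i : ℕ, i ≤ m → y + i ∈ Prod.fst '' B := fun i hi => by
    rw [hS]; exact ⟨i, hi, rfl⟩
  have hS' : ∀ i : ℕ, i ≤ m → i ≠ g → y + i ∈ Prod.fst '' B \ {u} := by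
    refine fun i hi hig => ⟨hSmem i hi, fun hiu => hig ?_⟩
    have h := add_left_cancel ((Set.mem_singleton_iff.1 hiu).trans hu)
    rwa [ZMod.natCast_eq_natCast_iff', Nat.mod_eq_of_lt (by omega),
      Nat.mod_eq_of_lt (by omega)] at h
  have hy' : y ∈ Prod.fst '' B \ {u} := by simpa using hS' 0 (by omega) (by omega)
  have hm' := hS' m le_rfl (by omega)
  have h2 := gap_add_gap hg0 hgm hS'
  have h3 : ∀ z : ℕ, 0 ≤ z → z ≤ 3 * m →
      y + y + y + z ∈ Prod.fst '' B \ {u} + Prod.fst '' B \ {u} + Prod.fst '' B := by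
    intro z _ hz
    by_cases hz1 : z ≤ 1
    · convert Set.add_mem_add (Set.add_mem_add hy' hy') (hSmem z (by omega)) using 1
      ring
    by_cases hz2 : z ≤ 3 * m - 2
    · exact interval_add h2 hy'.1 hm'.1 (by omega) z (by omega) (by omega)
    · convert Set.add_mem_add (Set.add_mem_add hm' hm') (hSmem (z - 2 * m) (by omega)) using 1
      push_cast [Nat.cast_sub (by omega : 2 * m ≤ z)]
      ring
  obtain ⟨v, hv1, hv2, hv⟩ := exists_offset (h.avoids (by omega))
    (add_itSum_interval_three (by omega) h3 hy'.1 hm'.1 (by omega)) hy'.1 hm'.1 (by omega)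
  obtain ⟨c, rfl⟩ : ∃ c, k = c + 3 := ⟨k - 3, by omega⟩
  rw [Nat.add_sub_cancel] at hv1
  have e2 : (c + 3) * m = c * m + 3 * m := by ring
  have e3 : (c + 3 + l) * m = c * m + 3 * m + l * m := by ring
  obtain ⟨j, rfl⟩ := Nat.exists_eq_add_of_le (show (c + 3) * m + 1 ≤ v by omega)
  exact hP.trivial_of_interval (by omega) hv fun b hb => hS ▸ ⟨b, hb, rfl⟩

/-- All large fibres lie above an interval, and the support has one further point not far away. -/
theorem KLParams.of_initial_interval (P : KLParams k l m lam p)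
    (h : NearlyFull k l m p n' B u) {U : ℕ}
    (hS' : ∀ i : ℕ, i ≤ m - 1 → y + i ∈ Prod.fst '' B \ {u}) (hu : u = y + U) (hmU : m ≤ U)
    (hU : U ≤ 3 * m - 4) : IsTrivialOrNormal k l m lam p n' B := by
  have : Fact p.Prime := ⟨P.hpp⟩
  have h5 := P.five_mul_lt
  have hP := P
  obtain ⟨hlk, hl, hkl, hlam, hp, hpp, hm7, hmkl⟩ := P
  have hy' : y ∈ Prod.fst '' B \ {u} := by simpa using hS' 0 (by omega)
  have huS : y + U ∈ Prod.fst '' B := hu ▸ h.mem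
  have h2 : ∀ z : ℕ, 0 ≤ z → z ≤ 2 * (m - 1) →
      y + y + z ∈ Prod.fst '' B \ {u} + Prod.fst '' B \ {u} := by
    intro z _ hz
    have := itSum_interval hS' 2 z hz
    rw [itSum_two] at this
    convert this using 1; push_cast; ring
  have h3 : ∀ z : ℕ, 0 ≤ z → z ≤ 2 * (m - 1) + U →
      y + y + y + z ∈ Prod.fst '' B \ {u} + Prod.fst '' B \ {u} + Prod.fst '' B := by
    intro z _ hz
    by_cases hz1 : z ≤ 2 * (m - 1) + (m - 1)
    · exact interval_add h2 hy'.1 (hS' (m - 1) le_rfl).1 (by omega) z (by omega) hz1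
    · convert Set.add_mem_add (h2 (z - U) (by omega) (by omega)) huS using 1
      push_cast [Nat.cast_sub (by omega : U ≤ z)]
      ring
  obtain ⟨v, hv1, hv2, -⟩ := exists_offset (h.avoids (by omega))
    (add_itSum_interval_three (by omega) h3 hy'.1 huS (by omega)) hy'.1 huS (by omega)
  have hUm : U = m := by
    obtain ⟨d, rfl⟩ := Nat.exists_eq_add_of_le hmU
    obtain ⟨c, rfl⟩ : ∃ c, k = c + 3 := ⟨k - 3, by omega⟩
    rw [Nat.add_sub_cancel] at hv1
    have e3 : (c + 3 + l) * m = c * m + 3 * m + l * m := by ring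
    have e4 : c * (m + d) = c * m + c * d := by ring
    have e5 : l * (m + d) = l * m + l * d := by ring
    have e6 : (c + l + 1) * d = c * d + l * d + d := by ring
    rcases Nat.eq_zero_or_pos d with rfl | hd
    · rfl
    · have := Nat.le_mul_of_pos_right (c + l + 1) hd
      omega
  subst hUm
  refine hP.of_interval_last h ?_ hu
  refine (Set.eq_of_subset_of_ncard_le ?_ ?_).symm
  · rintro _ ⟨i, hi, rfl⟩
    rcases hi.eq_or_lt with rfl | hi
    · exact huS
    · exact (hS' i (by omega)).1
  · rw [h.supp, ncard_Ival y (by omega)]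

theorem KLParams.not_isolated_of_gap (P : KLParams k l m lam p)
    (h : NearlyFull k l m p n' B u) {U g : ℕ} (hg : 0 < g) (hgm : g < m)
    (hS' : ∀ i : ℕ, i ≤ m → i ≠ g → y + i ∈ Prod.fst '' B \ {u}) (hu : u = y + U) (hmU : m < U)
    (hU : U ≤ 3 * m - 4) : False := by
  have : Fact p.Prime := ⟨P.hpp⟩
  obtain ⟨hlk, hl, hkl, hlam, hp, hpp, hm7, hmkl⟩ := P
  have hy' : y ∈ Prod.fst '' B \ {u} := by simpa using hS' 0 (by omega) (by omega)
  have hm' := hS' m le_rfl (by omega)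
  have huS : y + U ∈ Prod.fst '' B := hu ▸ h.mem
  have h2 := gap_add_gap hg hgm hS'
  have h3 : ∀ z : ℕ, 2 ≤ z → z ≤ 2 * m - 2 + U →
      y + y + y + z ∈ Prod.fst '' B \ {u} + Prod.fst '' B \ {u} + Prod.fst '' B := by
    intro z hz1 hz
    by_cases hz1 : z ≤ 2 * m - 2 + m
    · exact interval_add h2 hy'.1 hm'.1 (by omega) z (by omega) hz1
    · convert Set.add_mem_add (h2 (z - U) (by omega) (by omega)) huS using 1
      push_cast [Nat.cast_sub (by omega : U ≤ z)]
      ring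
  obtain ⟨v, hv1, hv2, hv⟩ := exists_offset (h.avoids (by omega))
    (add_itSum_interval_three (by omega) h3 hy'.1 huS (by omega)) hy'.1 huS (by omega)
  have hly : (l * y : ZMod p) ∈ itSum l (Prod.fst '' B) := by
    simpa using nsmul_mem_itSum hy'.1 l
  obtain ⟨d, rfl⟩ := Nat.exists_eq_add_of_le hmU.le
  obtain ⟨c, rfl⟩ : ∃ c, k = c + 3 := ⟨k - 3, by omega⟩
  rw [Nat.add_sub_cancel] at hv1
  have e3 : (c + 3 + l) * m = c * m + 3 * m + l * m := by ring
  have e4 : c * (m + d) = c * m + c * d := by ring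
  have e5 : l * (m + d) = l * m + l * d := by ring
  have e6 : (c + l + 1) * d = c * d + l * d + d := by ring
  obtain rfl : d = 1 := by
    by_contra hd
    have := Nat.mul_le_mul_left (c + l + 1) (show 2 ≤ d by omega)
    omega
  have key : ∀ a b : ℕ, a ≤ m → a ≠ g → b ≤ m → b ≠ g → ∀ e : ℕ,
      (e = m + 1 ∨ e ≤ m ∧ e ≠ g) → v ≠ c * (m + 1) + e + a + b := by
    rintro a b ha hag hb hbg e he rfl
    have heS : y + e ∈ Prod.fst '' B := by
      rcases he with rfl | ⟨he, heg⟩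
      · exact huS
      · exact (hS' e he heg).1
    refine h.avoids (by omega) _ ?_ hly
    rw [hv, show c + 3 - 2 = c + 1 by omega, itSum_succ]
    convert Set.add_mem_add (Set.add_mem_add (hS' a ha hag) (hS' b hb hbg))
      (Set.add_mem_add (nsmul_mem_itSum huS c) heS) using 1
    rw [nsmul_eq_mul]
    push_cast
    ring
  have k1 := key m m le_rfl (by omega) le_rfl (by omega) (m + 1) (Or.inl rfl)
  have k2 : v ≠ c * (m + 1) + 3 * m := by
    by_cases hg1 : g = m - 1
    · have := key m m le_rfl (by omega) le_rfl (by omega) m (Or.inr ⟨le_rfl, by omega⟩)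
      omega
    · have := key m (m - 1) le_rfl (by omega) (by omega) (by omega) (m + 1) (Or.inl rfl)
      omega
  omega

theorem KLParams.of_near_interval (P : KLParams k l m lam p) (h : NearlyFull k l m p n' B u)
    {U : ℕ} (hS' : Prod.fst '' B \ {u} ⊆ Ival y m) (hu : u = y + U) (hmU : m < U)
    (hU : U ≤ 3 * m - 4) : IsTrivialOrNormal k l m lam p n' B := by
  have : Fact p.Prime := ⟨P.hpp⟩
  have h5 := P.five_mul_lt
  have hm7 := P.hm7
  obtain ⟨g, hg, -, hS⟩ := exists_gap (by omega) hS' (by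
    rw [Set.ncard_sdiff_singleton_of_mem h.mem, h.supp, Nat.add_sub_cancel])
  rcases Nat.eq_zero_or_pos g with rfl | hg0
  · refine P.of_initial_interval h (y := y + 1) (U := U - 1) (fun i hi => ?_) ?_ (by omega)
      (by omega)
    · convert hS (i + 1) (by omega) (by omega) using 1
      push_cast; ring
    · rw [hu]; push_cast [Nat.cast_sub (by omega : 1 ≤ U)]; ring
  rcases hg.eq_or_lt with rfl | hgm
  · exact P.of_initial_interval h (fun i hi => hS i (by omega) (by omega)) hu hmU.le hU
  · exact (P.not_isolated_of_gap h hg0 hgm hS hu hmU hU).elim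

/-- The exceptional point cannot be far from the interval containing the rest of the support. -/
theorem KLParams.lt_add_of_three_mul_le (P : KLParams k l m lam p) (h : NearlyFull k l m p n' B u)
    {U : ℕ} (hS' : Prod.fst '' B \ {u} ⊆ Ival y m) (hu : u = y + U)
    (hU : 3 * m - 3 ≤ U) : p + m < U + (3 * m - 3) := by
  have : Fact p.Prime := ⟨P.hpp⟩
  have h5 := P.five_mul_lt
  obtain ⟨hlk, hl, hkl, hlam, hp, hpp, hm7, hmkl⟩ := P
  by_contra! hU2
  have huS : y + U ∈ Prod.fst '' B := hu ▸ h.mem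
  obtain ⟨g, hg, -, hS⟩ := exists_gap (by omega) hS' (by
    rw [Set.ncard_sdiff_singleton_of_mem h.mem, h.supp, Nat.add_sub_cancel])
  have h2 : ∀ z : ℕ, 2 ≤ z → z ≤ 2 * m - 2 →
      y + y + z ∈ Prod.fst '' B \ {u} + Prod.fst '' B \ {u} := by
    intro z hz hz2
    have key : ∀ i j : ℕ, i ≤ m → i ≠ g → j ≤ m → j ≠ g → i + j = z →
        y + y + z ∈ Prod.fst '' B \ {u} + Prod.fst '' B \ {u} := by
      rintro i j hi hig hj hjg rfl
      convert Set.add_mem_add (hS i hi hig) (hS j hj hjg) using 1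
      push_cast; ring
    rcases Nat.eq_zero_or_pos g with rfl | hg0
    · by_cases hzm : z ≤ m
      · exact key 1 (z - 1) (by omega) (by omega) (by omega) (by omega) (by omega)
      · exact key m (z - m) (by omega) (by omega) (by omega) (by omega) (by omega)
    rcases hg.eq_or_lt with rfl | hgm
    · by_cases hzm : z ≤ g - 1
      · exact key 0 z (by omega) (by omega) (by omega) (by omega) (by omega)
      · exact key (g - 1) (z - (g - 1)) (by omega) (by omega) (by omega) (by omega) (by omega)
    · exact gap_add_gap hg0 hgm hS z hz hz2
  set X := Prod.fst '' B \ {u} + Prod.fst '' B \ {u} + Prod.fst '' B with hX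
  have hX1 : Ival (y + y + y + ((3 : ℕ) : ZMod p)) (3 * m - 6) ⊆ X := by
    rintro _ ⟨i, hi, rfl⟩
    obtain ⟨j, hj, hjg, hji, hij⟩ : ∃ j : ℕ, j ≤ m ∧ j ≠ g ∧ j ≤ i + 1 ∧ i + 3 ≤ 2 * m - 2 + j := by
      by_cases hi2 : i + 3 ≤ 2 * m - 2
      · by_cases hg0 : g = 0
        · exact ⟨1, by omega, by omega, by omega, by omega⟩
        · exact ⟨0, by omega, by omega, by omega, by omega⟩
      · by_cases hg0 : g = m
        · exact ⟨m - 1, by omega, by omega, by omega, by omega⟩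
        · exact ⟨m, by omega, by omega, by omega, by omega⟩
    convert Set.add_mem_add (h2 (i + 3 - j) (by omega) (by omega)) (hS j hj hjg).1 using 1
    push_cast [Nat.cast_sub (by omega : j ≤ i + 3)]
    ring
  have hX2 : Ival (y + y + y + ((U + 2 : ℕ) : ZMod p)) (2 * m - 4) ⊆ X := by
    rintro _ ⟨i, hi, rfl⟩
    convert Set.add_mem_add (h2 (i + 2) (by omega) (by omega)) huS using 1
    push_cast; ring
  have hdisj : Disjoint (Ival (y + y + y + ((3 : ℕ) : ZMod p)) (3 * m - 6))
      (Ival (y + y + y + ((U + 2 : ℕ) : ZMod p)) (2 * m - 4)) := by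
    rw [Set.disjoint_left]
    rintro _ ⟨i, hi, rfl⟩ ⟨j, hj, hij⟩
    have : ((3 + i : ℕ) : ZMod p) = (U + 2 + j : ℕ) := by
      push_cast at hij ⊢; linear_combination hij
    rw [ZMod.natCast_eq_natCast_iff', Nat.mod_eq_of_lt (by omega)] at this
    rcases Nat.lt_or_ge (U + 2 + j) p with hlt | hge
    · rw [Nat.mod_eq_of_lt hlt] at this; omega
    · rw [Nat.mod_eq_sub_mod hge, Nat.mod_eq_of_lt (by omega)] at this; omega
  have hXcard := Set.ncard_le_ncard (Set.union_subset hX1 hX2)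
  rw [Set.ncard_union_eq hdisj, ncard_Ival _ (by omega), ncard_Ival _ (by omega)] at hXcard
  have hXne : X.Nonempty := Set.nonempty_of_ncard_ne_zero (by omega)
  have hSne : (Prod.fst '' B).Nonempty := ⟨_, h.mem⟩
  have hF := ncard_add_ge hpp hXne (itSum_nonempty hSne (k - 3))
  have hk := ncard_itSum_ge hpp h.supp.ge (k - 3)
  have hl' := ncard_itSum_ge hpp h.supp.ge l
  have hle := ncard_add_ncard_le_of_disjoint (h.avoids (by omega))
  obtain ⟨c, rfl⟩ : ∃ c, k = c + 3 := ⟨k - 3, by omega⟩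
  rw [show c + 3 - 2 = 1 + c by omega, itSum_add, itSum_one, ← add_assoc, ← hX,
    Nat.card_zmod] at hle
  rw [Nat.add_sub_cancel] at hF hk
  have e3 : (c + 3 + l) * m = c * m + 3 * m + l * m := by ring
  omega

theorem KLParams.of_subset_interval (P : KLParams k l m lam p) (h : NearlyFull k l m p n' B u)
    (hS' : Prod.fst '' B \ {u} ⊆ Ival y m) : IsTrivialOrNormal k l m lam p n' B := by
  have : Fact p.Prime := ⟨P.hpp⟩
  have h5 := P.five_mul_lt
  have hm7 := P.hm7
  have hu : u = y + ((u - y).val : ℕ) := by simp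
  have hlt := ZMod.val_lt (u - y)
  generalize (u - y).val = U at hu hlt
  rcases Nat.lt_or_ge m U with hmU | hmU
  · by_cases hU : U ≤ 3 * m - 4
    · exact P.of_near_interval h hS' hu hmU hU
    · have := P.lt_add_of_three_mul_le h hS' hu (by omega)
      refine IsTrivialOrNormal.of_image (dilate (-1) (neg_ne_zero.2 one_ne_zero))
        (P.of_near_interval (U := m + p - U) (y := -y - (m : ZMod p)) (h.image_dilate _) ?_ ?_
          (by omega) (by omega))
      · rw [fst_image_dilate, ← image_neg_one_mul_Ival]
        rintro _ ⟨⟨x, hx, rfl⟩, hxu⟩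
        exact ⟨x, hS' ⟨hx, fun hxu' => hxu (by rw [Set.mem_singleton_iff.1 hxu']; rfl)⟩, rfl⟩
      · rw [hu]
        push_cast [Nat.cast_sub (by omega : U ≤ m + p)]
        rw [ZMod.natCast_self]
        ring
  · refine P.of_interval h (Set.eq_of_subset_of_ncard_le (fun x hx => ?_) ?_) (y := y)
    · by_cases hxu : x = u
      · exact ⟨U, hmU, hxu.trans hu⟩
      · exact hS' ⟨hx, hxu⟩
    · rw [h.supp, ncard_Ival y (by omega)]

theorem ncard_le_fst_mul [Fact p.Prime] (B : Set (ZMod p × (Fin n' → ZMod p))) :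
    B.ncard ≤ (Prod.fst '' B).ncard * p ^ n' := by
  rw [← ncard_prod_univ]
  exact Set.ncard_le_ncard fun b hb => ⟨⟨b, hb, rfl⟩, trivial⟩

theorem eq_prod_univ_of_card [Fact p.Prime] (hcard : m * p ^ n' ≤ B.ncard)
    (hS : (Prod.fst '' B).ncard = m) : B = (Prod.fst '' B) ×ˢ Set.univ :=
  Set.eq_of_subset_of_ncard_le (fun b hb => ⟨⟨b, hb, rfl⟩, trivial⟩) (by
    rwa [ncard_prod_univ, hS])

theorem KLFree.fst_of_eq_prod (hfree : KLFree k l B) (hB : B = (Prod.fst '' B) ×ˢ Set.univ) :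
    KLFree k l (Prod.fst '' B) := by
  have hsub : AddMonoidHom.inl (ZMod p) (Fin n' → ZMod p) '' (Prod.fst '' B) ⊆ B := by
    rintro _ ⟨x, hx, rfl⟩
    rw [hB]
    exact ⟨hx, trivial⟩
  have hmem : ∀ j, ∀ s ∈ itSum j (Prod.fst '' B), (s, (0 : Fin n' → ZMod p)) ∈ itSum j B := by
    intro j s hs
    have := itSum_mono hsub j
    rw [itSum_image] at this
    exact this ⟨s, hs, rfl⟩
  exact KLFree.of_disjoint fun s hk hl => hfree.disjoint (hmem k s hk) (hmem l s hl)

theorem KLParams.of_prod_subset_interval (P : KLParams k l m lam p) (hfree : KLFree k l B)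
    (hcard : m * p ^ n' ≤ B.ncard) (hS : (Prod.fst '' B).ncard = m)
    (hSy : Prod.fst '' B ⊆ Ival y m) : IsTrivialOrNormal k l m lam p n' B := by
  have : Fact p.Prime := ⟨P.hpp⟩
  have h5 := P.five_mul_lt
  have hm7 := P.hm7
  have hB := eq_prod_univ_of_card hcard hS
  have hfreeS := hfree.fst_of_eq_prod hB
  have hcard' : B.ncard = m * p ^ n' :=
    le_antisymm ((ncard_le_fst_mul B).trans_eq (by rw [hS])) hcard
  have htype1 : ∀ a : ZMod p, Ival a (m - 1) ⊆ Prod.fst '' B →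
      IsTrivialOrNormal k l m lam p n' B := by
    intro a ha
    have heq := Set.eq_of_subset_of_ncard_le ha (by rw [hS, ncard_Ival a (by omega)]; omega)
    refine P.type1_of_interval (y := a) ?_ hcard' (heq ▸ hfreeS)
    rw [hB, ← heq]
    ext b
    simp [cub]
  obtain ⟨g, hg, -, hgS⟩ := exists_gap (by omega) hSy hS
  rcases Nat.eq_zero_or_pos g with rfl | hg0
  · refine htype1 (y + 1) ?_
    rintro _ ⟨i, hi, rfl⟩
    convert hgS (i + 1) (by omega) (by omega) using 1
    push_cast; ring
  rcases hg.eq_or_lt with rfl | hgm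
  · refine htype1 y ?_
    rintro _ ⟨i, hi, rfl⟩
    exact hgS i (by omega) (by omega)
  · obtain ⟨j, hj, hy⟩ := P.position_of_gap hg0 hgm hgS hfreeS
    exact P.trivial_of_interval hj hy fun b hb => hSy ⟨b, hb, rfl⟩

/-- The classification in the model space `F_p × F_p^{n'}`. -/
theorem KLParams.isTrivialOrNormal (P : KLParams k l m lam p) {τ : ℝ} (hτ0 : 0 < τ)
    (hfeas : Feasible (1 / (k + l : ℝ)) τ) (hm1 : 5 / τ ≤ (m : ℝ)) (hfree : KLFree k l B)
    (hcard : m * p ^ n' ≤ B.ncard) (hw : (Prod.fst '' B).ncard ≤ m + 1) :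
    IsTrivialOrNormal k l m lam p n' B := by
  have : Fact p.Prime := ⟨P.hpp⟩
  have h5 := P.five_mul_lt
  have hm7 := P.hm7
  have hlk := P.hlk
  have hl := P.hl
  have hge : m ≤ (Prod.fst '' B).ncard :=
    Nat.le_of_mul_le_mul_right (hcard.trans (ncard_le_fst_mul B)) (pow_pos P.hpp.pos n')
  obtain hS | hS : (Prod.fst '' B).ncard = m ∨ (Prod.fst '' B).ncard = m + 1 := by omega
  · obtain ⟨y, d, hd, hyd⟩ := P.exists_progression hτ0 hfeas hm1 hS
      (hfree.fst_of_eq_prod (eq_prod_univ_of_card hcard hS))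
    refine IsTrivialOrNormal.of_image (dilate d⁻¹ (inv_ne_zero hd))
      (P.of_prod_subset_interval (y := d⁻¹ * y) (hfree.image_equiv _) ?_ ?_ ?_)
    · rwa [Set.ncard_image_of_injective _ (dilate d⁻¹ _).injective]
    · rw [fst_image_dilate, Set.ncard_image_of_injective _ (mul_right_injective₀ (inv_ne_zero hd)),
        hS]
    · rw [fst_image_dilate]
      rintro _ ⟨x, hx, rfl⟩
      obtain ⟨i, hi, rfl⟩ := hyd x hx
      exact ⟨i, hi, by field_simp⟩
  · obtain ⟨u, hu, hmin⟩ := Set.exists_min_image (Prod.fst '' B) (fun i => (fiber B i).ncard)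
      (Set.toFinite _) (Set.nonempty_of_ncard_ne_zero (by omega))
    have h : NearlyFull k l m p n' B u := by
      refine ⟨hfree, hcard, hS, hu, fun i hi hiu => ?_⟩
      have h1 := ncard_fiber_add_ge (by omega) hcard hS hu hi (Ne.symm hiu)
      have h2 := hmin i hi
      obtain ⟨t, ht⟩ := (P.hpp.odd_of_ne_two (by omega)).pow (n := n')
      omega
    obtain ⟨y, d, hd, hyd⟩ := P.exists_progression hτ0 hfeas hm1 (by
      rw [Set.ncard_sdiff_singleton_of_mem hu, hS, Nat.add_sub_cancel]) (h.free_diff (by omega))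
    refine IsTrivialOrNormal.of_image (dilate d⁻¹ (inv_ne_zero hd))
      (P.of_subset_interval (y := d⁻¹ * y) (h.image_dilate _) ?_)
    rw [fst_image_dilate]
    rintro _ ⟨⟨x, hx, rfl⟩, hxu⟩
    obtain ⟨i, hi, rfl⟩ := hyd x
      ⟨hx, fun hxu' => hxu (by rw [Set.mem_singleton_iff.1 hxu']; rfl)⟩
    exact ⟨i, hi, by field_simp⟩

end Classification

/-- The coordinates on `F_p^n` attached to a decomposition `(v, K)`. -/
theorem exists_equiv_of_decomposition {p n : ℕ} [Fact p.Prime] (hn : 1 ≤ n)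
    {v : Fin n → ZMod p} {K : Submodule (ZMod p) (Fin n → ZMod p)}
    (hK : Module.finrank (ZMod p) K = n - 1) (hv : v ∉ K) :
    ∃ e : (Fin n → ZMod p) ≃+ (ZMod p × (Fin (n - 1) → ZMod p)),
      ∀ A, Prod.fst '' (e '' A) ⊆ supp v K A := by
  let f : (ZMod p × K) →ₗ[ZMod p] (Fin n → ZMod p) :=
    (LinearMap.toSpanSingleton (ZMod p) _ v).coprod K.subtype
  have hf : Function.Injective f := by
    rw [← LinearMap.ker_eq_bot, LinearMap.ker_eq_bot']
    rintro ⟨i, w⟩ hiw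
    have hiw' : i • v + (w : Fin n → ZMod p) = 0 := by simpa [f] using hiw
    have hi : i = 0 := by
      by_contra hi
      refine hv ((K.smul_mem_iff hi).1 ?_)
      rw [eq_neg_of_add_eq_zero_left hiw']
      exact K.neg_mem w.2
    subst hi
    have hw : w = 0 := by simpa using hiw'
    rw [hw]; rfl
  let g : K ≃ₗ[ZMod p] (Fin (n - 1) → ZMod p) := LinearEquiv.ofFinrankEq _ _ (by simp [hK])
  let F := LinearMap.linearEquivOfInjective f hf (by
    rw [Module.finrank_prod, hK]; simp; omega)
  refine ⟨(F.symm.trans ((LinearEquiv.refl _ _).prodCongr g)).toAddEquiv, ?_⟩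
  rintro A _ ⟨_, ⟨a, ha, rfl⟩, rfl⟩
  refine ⟨(F.symm a).2, (F.symm a).2.2, ?_⟩
  have : f (F.symm a) = a := F.apply_symm_apply a
  convert ha using 1
  conv_rhs => rw [← this]
  exact add_comm _ _

/-- (Small-weight case.) If `A` is a nontrivial `(k,ℓ)`-sum-free set
with `|A| ≥ m·p^(n-1)` and some decomposition has `ω(A) ≤ m+1`, then `A` is normal. -/
theorem stmt19 (k l n m lam p : ℕ) (τ : ℝ)
    (hlk : l < k) (hl : 1 ≤ l) (hkl : 5 ≤ k + l) (hlam : lam ≤ k + l - 5)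
    (hp : p = (k + l) * m + 2 + lam) (hpp : p.Prime) (hn : 1 ≤ n)
    (hτ0 : 0 < τ) (hτ1 : τ ≤ 1) (hfeas : Feasible (1 / (k + l : ℝ)) τ)
    (hm7 : 7 ≤ m) (hmkl : k + l - 1 ≤ m) (hm1 : 5 / τ ≤ (m : ℝ))
    (A : Set (Fin n → ZMod p)) (hA : A.Nonempty) (hfree : KLFree k l A)
    (hnt : ¬ IsTrivialKL k l m lam p n A) (hcard : m * p ^ (n - 1) ≤ A.ncard)
    (v : Fin n → ZMod p) (K : Submodule (ZMod p) (Fin n → ZMod p))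
    (hK : Module.finrank (ZMod p) K = n - 1) (hv : v ∉ K)
    (hw : weight v K A ≤ m + 1) :
    IsNormalKL k l m lam p n A := by
  have hpf : Fact p.Prime := ⟨hpp⟩
  have P : KLParams k l m lam p := ⟨hlk, hl, hkl, by omega, hp, hpp, hm7, by omega⟩
  obtain ⟨e₀, he₀⟩ := exists_equiv_of_decomposition hn hK hv
  have hncard : (e₀ '' A).ncard = A.ncard := Set.ncard_image_of_injective _ e₀.injective
  obtain ⟨e, he⟩ := P.isTrivialOrNormal hτ0 hfeas hm1 (hfree.image_equiv e₀)
    (by rwa [hncard]) ((Set.ncard_le_ncard (he₀ A)).trans hw)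
  rw [hncard, ← Set.image_comp, ← AddEquiv.coe_trans] at he
  rcases he with ⟨j, hj, hsub⟩ | ⟨hA1, a, ha, himg⟩ | ⟨hl1, hA1, V, hV, himg⟩
  · exact (hnt ⟨e₀.trans e, j, hj, hsub⟩).elim
  · exact Or.inl ⟨hA1, e₀.trans e, a, ha, himg⟩
  · refine Or.inr ⟨hl1, ?_, hA1, e₀.trans e, V, hV, himg⟩
    by_contra hn2
    obtain rfl : n = 1 := by omega
    have : Subsingleton (Fin (1 - 1) → ZMod p) := inferInstanceAs (Subsingleton (Fin 0 → ZMod p))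
    exact hV (Submodule.eq_top_iff'.2 fun x => by rw [Subsingleton.elim x 0]; exact V.zero_mem)
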